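/- (Brin–Katok entropy formula for amenable group actions, non-ergodic case.) Let G be a countable discrete infinite amenable group acting continuously on a compact metric space (X,d), let μ be a G-invariant Borel probability measure on X, and let {F_n} be a tempered Følner sequence in G with lim_{n→∞} |F_n|/log n = ∞. Then for μ-almost every x ∈ X, lim_{δ→0} liminf_{n→∞} −(1/|F_n|) log μ(B_{F_n}(x,δ)) = lim_{δ→0} limsup_{n→∞} −(1/|F_n|) log μ(B_{F_n}(x,δ)) =: h_μ(x), where h_μ(·) is a G-invariant measurable function (with values in [0,∞]) satisfying ∫_X h_μ(x) dμ = h_μ(X,G). -/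

import Mathlib

open MeasureTheory Filter Set
open scoped Pointwise ENNReal NNReal Topology

section Defs

variable {G : Type*} [Group G] [DecidableEq G] {X : Type*}

/-- A Følner sequence: a sequence of nonempty finite subsets of `G` that is asymptotically
invariant: `|Fₙ △ gFₙ|/|Fₙ| → 0` for every `g ∈ G`. -/
def IsFolnerSeq (F : ℕ → Finset G) : Prop :=
  (∀ n, (F n).Nonempty) ∧
    ∀ g : G, Tendsto (fun n => ((symmDiff (F n) ((F n).image (g * ·))).card : ℝ) / (F n).card)
      atTop (𝓝 0)

/-- A sequence of finite subsets is tempered if `|⋃_{k<n} Fₖ⁻¹ Fₙ| ≤ C |Fₙ|` for a constant `C`. -/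
def IsTemperedSeq (F : ℕ → Finset G) : Prop :=
  ∃ C : ℝ, ∀ n : ℕ, (((Finset.range n).biUnion fun k => (F k)⁻¹ * F n).card : ℝ) ≤ C * (F n).card

/-- The growth condition `|Fₙ|/log n → ∞`. -/
def GrowthCond (F : ℕ → Finset G) : Prop :=
  Tendsto (fun n => ((F n).card : ℝ) / Real.log n) atTop atTop

variable [MetricSpace X] [MulAction G X]

/-- The Bowen ball `B_F(x,ε) = {y : d(gx, gy) < ε for all g ∈ F}`. -/
def bowenBall (F : Finset G) (x : X) (ε : ℝ) : Set X :=
  {y | ∀ g ∈ F, dist (g • x) (g • y) < ε}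

/-- `M(Z,N,ε,s,{Fₙ})`: infimum of `Σᵢ exp(-s |F_{nᵢ}|)` over countable families of Bowen balls
`B_{F_{nᵢ}}(xᵢ,ε)` with `nᵢ ≥ N` covering `Z`. -/
noncomputable def bowenMpre (F : ℕ → Finset G) (Z : Set X) (N : ℕ) (ε s : ℝ) : ℝ≥0∞ :=
  ⨅ (C : Set (X × ℕ)) (_ : C.Countable ∧ (∀ p ∈ C, N ≤ p.2) ∧
      Z ⊆ ⋃ p ∈ C, bowenBall (F p.2) p.1 ε),
    ∑' p : C, ENNReal.ofReal (Real.exp (-s * ((F (p : X × ℕ).2).card : ℝ)))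

/-- `M(Z,s,{Fₙ}) = lim_{ε→0} lim_{N→∞} M(Z,N,ε,s,{Fₙ})`; since the quantity is monotone
(nondecreasing as `N` increases and as `ε` decreases), the limits are suprema. -/
noncomputable def bowenMeasure (F : ℕ → Finset G) (Z : Set X) (s : ℝ) : ℝ≥0∞ :=
  ⨆ (ε : ℝ) (_ : 0 < ε), ⨆ N : ℕ, bowenMpre F Z N ε s

/-- The Bowen topological entropy of `Z` along `{Fₙ}`: the critical value of `s` at which
`M(Z,s,{Fₙ})` jumps from `+∞` to `0`. -/
noncomputable def bowenEntropy (F : ℕ → Finset G) (Z : Set X) : ℝ≥0∞ :=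
  ⨆ (s : ℝ) (_ : bowenMeasure F Z s = ⊤), ENNReal.ofReal s

/-- The minimal cardinality of a subcover of `⋁_{g ∈ F} g⁻¹ U` for a cover `U`. -/
noncomputable def coverNumber (U : Finset (Set X)) (F : Finset G) : ℕ :=
  sInf {k : ℕ | ∃ f : Fin k → G → Set X, (∀ i, ∀ g ∈ F, f i g ∈ U) ∧
    (univ : Set X) ⊆ ⋃ i, ⋂ g ∈ F, (fun x => g • x) ⁻¹' f i g}

/-- The topological entropy of the `G`-action on `X` (computed along `{Fₙ}`; it is independent
of the Følner sequence). -/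
noncomputable def topEntropy (X : Type*) [MetricSpace X] {G : Type*} [Group G] [MulAction G X]
    (F : ℕ → Finset G) : ℝ≥0∞ :=
  ⨆ (U : Finset (Set X)) (_ : (∀ V ∈ U, IsOpen V) ∧ ⋃₀ (U : Set (Set X)) = univ),
    limsup (fun n => ENNReal.ofReal (Real.log (coverNumber U (F n)) / (F n).card)) atTop

end Defs

section MeasDefs

variable {G : Type*} [Group G] [DecidableEq G] {X : Type*} [MeasurableSpace X] [MulAction G X]

/-- The Shannon entropy `H_μ(⋁_{g∈F} g⁻¹ P)` of the join over `F` of the finite measurable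
partition `P` given by the fibers of `α`. -/
noncomputable def partitionEntropy (μ : Measure X) {ι : Type*} [Fintype ι] (α : X → ι)
    (F : Finset G) : ℝ :=
  ∑ f : ↥F → ι, Real.negMulLog ((μ {x | ∀ g : ↥F, α ((g : G) • x) = f g}).toReal)

/-- The entropy `h_μ(G,P) = lim_n H_μ(P^{Fₙ})/|Fₙ|` of the partition given by the fibers
of `α` (the limit existing, it is the `limsup`). -/
noncomputable def partitionDynEntropy (F : ℕ → Finset G) (μ : Measure X) {ι : Type*} [Fintype ι]
    (α : X → ι) : ℝ :=
  limsup (fun n => partitionEntropy μ α (F n) / (F n).card) atTop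

/-- The measure-theoretic entropy `h_μ(X,G)`: the supremum over finite measurable partitions
(encoded as measurable maps `X → Fin k`) of `lim_n H_μ(P^{Fₙ})/|Fₙ|`. -/
noncomputable def measEntropy (F : ℕ → Finset G) (μ : Measure X) : ℝ≥0∞ :=
  ⨆ (k : ℕ) (α : X → Fin k) (_ : Measurable α),
    limsup (fun n => ENNReal.ofReal (partitionEntropy μ α (F n) / (F n).card)) atTop

/-- `μ` is `G`-invariant. -/
def InvariantMeasure (G : Type*) [Group G] [MulAction G X] (μ : Measure X) : Prop :=
  ∀ g : G, Measure.map (fun x => g • x) μ = μ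

/-- `μ` is ergodic: every Borel set `A` with `μ(A △ g⁻¹A) = 0` for all `g` is trivial. -/
def ErgodicMeasure (G : Type*) [Group G] [MulAction G X] (μ : Measure X) : Prop :=
  ∀ A : Set X, MeasurableSet A →
    (∀ g : G, μ (symmDiff A ((fun x => g • x) ⁻¹' A)) = 0) → μ A = 0 ∨ μ A = 1

end MeasDefs

section LocalDefs

variable {G : Type*} [Group G] [DecidableEq G] {X : Type*} [MetricSpace X] [MulAction G X]
  [MeasurableSpace X]

/-- The set of generic points of `μ` with respect to `{Fₙ}`. -/
def genericPointSet (F : ℕ → Finset G) (μ : Measure X) : Set X :=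
  {x | ∀ f : C(X, ℝ),
    Tendsto (fun n => (∑ g ∈ F n, f (g • x)) / (F n).card) atTop (𝓝 (∫ y, f y ∂μ))}

/-- The lower local entropy of `μ` at `x` along `{Fₙ}`:
`lim_{δ→0} liminf_n -(1/|Fₙ|) log μ(B_{Fₙ}(x,δ))` (the limit in `δ` being a supremum
by monotonicity). -/
noncomputable def localLowerEntropy (F : ℕ → Finset G) (μ : Measure X) (x : X) : ℝ≥0∞ :=
  ⨆ (δ : ℝ) (_ : 0 < δ),
    liminf (fun n =>
      ENNReal.ofReal (-(Real.log ((μ (bowenBall (F n) x δ)).toReal)) / (F n).card)) atTop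

end LocalDefs

section Proof

open MeasureTheory Filter Set
open scoped Pointwise ENNReal NNReal Topology

section Cover
variable {G : Type*} [Group G] [DecidableEq G]

/-- right translate of a finite set -/
def tile (S : Finset G) (c : G) : Finset G := S.image (· * c)

lemma mem_tile {S : Finset G} {c h : G} : h ∈ tile S c ↔ h * c⁻¹ ∈ S := by
  simp only [tile, Finset.mem_image]
  constructor
  · rintro ⟨a, ha, rfl⟩; simpa using ha
  · intro hh; exact ⟨_, hh, by simp⟩

lemma card_tile (S : Finset G) (c : G) : (tile S c).card = S.card :=
  Finset.card_image_of_injective _ (mul_left_injective c)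

/-- union of tiles -/
def tiles (F : ℕ → Finset G) (j : G → ℕ) (D : Finset G) : Finset G :=
  D.biUnion fun c => tile (F (j c)) c

lemma mem_tiles {F : ℕ → Finset G} {j : G → ℕ} {D : Finset G} {h : G} :
    h ∈ tiles F j D ↔ ∃ c ∈ D, h * c⁻¹ ∈ F (j c) := by
  simp [tiles, mem_tile]

lemma card_tile_mem_le (S A : Finset G) (h : G) :
    (A.filter fun c => h ∈ tile S c).card ≤ S.card := by
  apply Finset.card_le_card_of_injOn (fun c => h * c⁻¹)
  · intro c hc
    simp only [Finset.coe_filter, Set.mem_setOf_eq, mem_tile] at hc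
    exact hc.2
  · intro a _ b _ hab
    simpa using hab

lemma cover_level (S : Finset G) (hS : S.Nonempty) (η : ℝ) (hη1 : η < 1)
    (f : G → ℝ) (hf : ∀ h, 0 ≤ f h) (lam : ℝ) (hl : 0 < lam) (A : Finset G)
    (hA : ∀ c ∈ A, lam * S.card ≤ ∑ h ∈ tile S c, f h) :
    ∃ D ⊆ A, (1 - η) * lam * (D.card * S.card) ≤ ∑ h ∈ D.biUnion (tile S), f h ∧
      lam * η * A.card ≤ ∑ h ∈ D.biUnion (tile S), f h := by
  have hne : (A.powerset.filter fun D =>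
      (1 - η) * lam * (D.card * S.card) ≤ ∑ h ∈ D.biUnion (tile S), f h).Nonempty :=
    ⟨∅, by simp⟩
  obtain ⟨D, hD, hmax⟩ := Finset.exists_max_image _ (fun D => D.card) hne
  simp only [Finset.mem_filter, Finset.mem_powerset] at hD hmax
  refine ⟨D, hD.1, hD.2, ?_⟩
  set K := D.biUnion (tile S) with hK
  have hSpos : (0 : ℝ) < S.card := by exact_mod_cast hS.card_pos
  have key : ∀ c ∈ A, lam * η * S.card ≤ ∑ h ∈ tile S c ∩ K, f h := by
    intro c hc
    by_cases hcD : c ∈ D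
    · have : tile S c ∩ K = tile S c :=
        Finset.inter_eq_left.2 (Finset.subset_biUnion_of_mem (tile S) hcD)
      rw [this]
      refine le_trans ?_ (hA c hc)
      have : 0 < lam * S.card := by positivity
      nlinarith
    · by_contra hlt
      push Not at hlt
      have hins : insert c D ⊆ A := Finset.insert_subset hc hD.1
      have hsum : ∑ h ∈ (insert c D).biUnion (tile S), f h
          = ∑ h ∈ tile S c \ K, f h + ∑ h ∈ K, f h := by
        rw [Finset.biUnion_insert, ← hK, ← Finset.sdiff_union_self_eq_union,
          Finset.sum_union Finset.sdiff_disjoint]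
      have hsplit : ∑ h ∈ tile S c ∩ K, f h + ∑ h ∈ tile S c \ K, f h = ∑ h ∈ tile S c, f h :=
        Finset.sum_inter_add_sum_sdiff _ _ _
      have h1 := hA c hc
      have := hmax (insert c D) ⟨hins, by
        rw [hsum, Finset.card_insert_of_notMem hcD]
        push_cast
        nlinarith [hD.2]⟩
      rw [Finset.card_insert_of_notMem hcD] at this
      omega
  have hsum : ∑ c ∈ A, ∑ h ∈ tile S c ∩ K, f h ≤ S.card * ∑ h ∈ K, f h := by
    have : ∀ c, ∑ h ∈ tile S c ∩ K, f h = ∑ h ∈ K, if h ∈ tile S c then f h else 0 := by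
      intro c
      rw [Finset.inter_comm, ← Finset.sum_filter, Finset.filter_mem_eq_inter]
    simp_rw [this]
    rw [Finset.sum_comm, Finset.mul_sum]
    apply Finset.sum_le_sum
    intro h _
    rw [← Finset.sum_filter, Finset.sum_const, nsmul_eq_mul]
    exact mul_le_mul_of_nonneg_right (by exact_mod_cast card_tile_mem_le S A h) (hf h)
  have hlow : (A.card : ℝ) * (lam * η * S.card) ≤ ∑ c ∈ A, ∑ h ∈ tile S c ∩ K, f h := by
    rw [← nsmul_eq_mul]
    exact Finset.card_nsmul_le_sum _ _ _ key
  have := hlow.trans hsum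
  have h2 : S.card * (lam * η * A.card) ≤ S.card * ∑ h ∈ K, f h := by linarith
  exact le_of_mul_le_mul_left h2 hSpos

lemma cover (F : ℕ → Finset G) (hne : ∀ n, (F n).Nonempty) (C : ℝ) (hC0 : 0 ≤ C)
    (hC : ∀ n : ℕ, (((Finset.range n).biUnion fun k => (F k)⁻¹ * F n).card : ℝ) ≤ C * (F n).card)
    (η : ℝ) (hη0 : 0 < η) (hη1 : η < 1)
    (f : G → ℝ) (hf : ∀ h, 0 ≤ f h) (lam : ℝ) (hl : 0 < lam) (j : G → ℕ) (A : Finset G)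
    (hA : ∀ c ∈ A, lam * (F (j c)).card ≤ ∑ h ∈ tile (F (j c)) c, f h) :
    ∃ D ⊆ A, (1 - η) * lam * ∑ c ∈ D, ((F (j c)).card : ℝ) ≤ ∑ h ∈ tiles F j D, f h ∧
      lam * A.card ≤ (1 / η + C / (1 - η)) * ∑ h ∈ tiles F j D, f h := by
  induction hn : A.card using Nat.strong_induction_on generalizing A with
  | _ n ih =>
  by_cases hAe : A.Nonempty
  swap
  · rw [Finset.not_nonempty_iff_eq_empty] at hAe
    subst hAe
    refine ⟨∅, by simp, by simp [tiles], ?_⟩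
    simp at hn
    subst hn
    simp [tiles]
  obtain ⟨c0, hc0, hmax⟩ := Finset.exists_max_image A j hAe
  set top := j c0 with htop
  set At := A.filter (fun c => j c = top) with hAt
  obtain ⟨D, hDA, hD1, hD2⟩ := cover_level (F top) (hne top) η hη1 f hf lam hl At (by
    intro c hc
    rw [hAt, Finset.mem_filter] at hc
    have := hA c hc.1
    rwa [hc.2] at this)
  set K := D.biUnion (tile (F top)) with hK
  have hjD : ∀ c ∈ D, j c = top := fun c hc => (Finset.mem_filter.1 (hDA hc)).2
  have hKt : tiles F j D = K := by
    unfold tiles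
    exact Finset.biUnion_congr rfl (fun c hc => by rw [hjD c hc])
  set A' := A.filter (fun c => j c ≠ top ∧ Disjoint (tile (F (j c)) c) K) with hA'
  have hA'sub : A' ⊆ A := Finset.filter_subset _ _
  have hlt : A'.card < n := by
    rw [← hn]
    apply Finset.card_lt_card
    refine ⟨hA'sub, fun hh => ?_⟩
    have := hh hc0
    rw [hA', Finset.mem_filter] at this
    exact this.2.1 rfl
  obtain ⟨D', hD'A, hD'1, hD'2⟩ := ih _ hlt A' (fun c hc => hA c (hA'sub hc)) rfl
  have hdisjK : Disjoint (tiles F j D) (tiles F j D') := by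
    rw [hKt, Finset.disjoint_left]
    intro h hhK hh'
    rw [mem_tiles] at hh'
    obtain ⟨c, hc, hcc⟩ := hh'
    have := (Finset.mem_filter.1 (hD'A hc)).2.2
    exact Finset.disjoint_left.1 this (mem_tile.2 hcc) hhK
  have hdisjD : Disjoint D D' := by
    rw [Finset.disjoint_left]
    intro c hc hc'
    exact (Finset.mem_filter.1 (hD'A hc')).2.1 (hjD c hc)
  have hunion : tiles F j (D ∪ D') = tiles F j D ∪ tiles F j D' := by
    unfold tiles; rw [Finset.union_biUnion]
  have hS : ∑ h ∈ tiles F j (D ∪ D'), f h = ∑ h ∈ K, f h + ∑ h ∈ tiles F j D', f h := by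
    rw [hunion, Finset.sum_union hdisjK, hKt]
  refine ⟨D ∪ D', Finset.union_subset (hDA.trans (Finset.filter_subset _ _)) (hD'A.trans hA'sub),
    ?_, ?_⟩
  · rw [hS, Finset.sum_union hdisjD, mul_add]
    refine add_le_add ?_ hD'1
    rw [Finset.sum_congr rfl (fun c hc => by rw [hjD c hc]), Finset.sum_const, nsmul_eq_mul]
    exact hD1
  · rw [hS, mul_add, ← hn]
    set B := (Finset.range top).biUnion fun k => (F k)⁻¹ * F top with hB
    have hsub : A ⊆ (At ∪ A') ∪ D.biUnion (tile B) := by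
      intro c hc
      by_cases h1 : j c = top
      · simp [hAt, hc, h1]
      by_cases h2 : Disjoint (tile (F (j c)) c) K
      · simp [hA', hc, h1, h2]
      · rw [Finset.not_disjoint_iff] at h2
        obtain ⟨h, hh1, hh2⟩ := h2
        rw [hK, Finset.mem_biUnion] at hh2
        obtain ⟨b, hb, hhb⟩ := hh2
        refine Finset.mem_union_right _ (Finset.mem_biUnion.2 ⟨b, hb, ?_⟩)
        rw [mem_tile] at hh1 hhb ⊢
        rw [hB, Finset.mem_biUnion]
        refine ⟨j c, Finset.mem_range.2 (lt_of_le_of_ne (hmax c hc) h1), ?_⟩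
        rw [Finset.mem_mul]
        exact ⟨(h * c⁻¹)⁻¹, Finset.inv_mem_inv hh1, h * b⁻¹, hhb, by group⟩
    have hcard : (A.card : ℝ) ≤ At.card + A'.card + D.card * (C * (F top).card) := by
      have h1 : A.card ≤ At.card + A'.card + D.card * B.card := by
        refine (Finset.card_le_card hsub).trans ((Finset.card_union_le _ _).trans ?_)
        refine add_le_add (Finset.card_union_le _ _) ?_
        refine Finset.card_biUnion_le.trans ?_
        simp [card_tile]
      have h2 : (A.card : ℝ) ≤ At.card + A'.card + D.card * B.card := by exact_mod_cast h1
      have h3 := hC top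
      rw [← hB] at h3
      have h4 : (D.card : ℝ) * B.card ≤ D.card * (C * (F top).card) :=
        mul_le_mul_of_nonneg_left h3 (by positivity)
      linarith
    have e1 : lam * At.card ≤ 1 / η * ∑ h ∈ K, f h := by
      rw [div_mul_eq_mul_div, le_div_iff₀ hη0]; linarith
    have e2 : lam * (D.card * (C * (F top).card)) ≤ C / (1 - η) * ∑ h ∈ K, f h := by
      rw [div_mul_eq_mul_div, le_div_iff₀ (by linarith)]
      calc _ = C * ((1 - η) * lam * (D.card * (F top).card)) := by ring
        _ ≤ _ := mul_le_mul_of_nonneg_left hD1 hC0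
    have e3 := mul_le_mul_of_nonneg_left hcard hl.le
    nlinarith
end Cover

section Folner
variable {G : Type*} [Group G] [DecidableEq G]

/-- interior of `S` with respect to `T` -/
def intr (T S : Finset G) : Finset G := S.filter fun c => ∀ t ∈ T, t * c ∈ S

lemma folner_tendsto {F : ℕ → Finset G} (hFol : IsFolnerSeq F) (t : G) (s : ℝ) (hs : 0 < s) :
    ∀ᶠ n in atTop, ((((F n).filter fun c => t * c ∉ F n).card : ℝ)) ≤ s * (F n).card := by
  have h := hFol.2 t⁻¹
  filter_upwards [h.eventually (gt_mem_nhds hs)] with n hn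
  have hpos : (0 : ℝ) < (F n).card := by exact_mod_cast (hFol.1 n).card_pos
  rw [div_lt_iff₀ hpos] at hn
  refine le_trans ?_ hn.le
  have : (F n).filter (fun c => t * c ∉ F n) ⊆ symmDiff (F n) ((F n).image (t⁻¹ * ·)) := by
    intro c hc
    rw [Finset.mem_filter] at hc
    rw [Finset.mem_symmDiff]
    refine Or.inl ⟨hc.1, fun hh => ?_⟩
    obtain ⟨a, ha, hac⟩ := Finset.mem_image.1 hh
    apply hc.2
    rw [← hac]; simpa using ha
  exact_mod_cast Finset.card_le_card this

lemma card_sdiff_intr_le (T S : Finset G) :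
    (S \ intr T S).card ≤ ∑ t ∈ T, (S.filter fun c => t * c ∉ S).card := by
  refine le_trans (Finset.card_le_card ?_) (Finset.card_biUnion_le (s := T)
    (t := fun t => S.filter fun c => t * c ∉ S))
  intro c hc
  simp only [intr, Finset.mem_sdiff, Finset.mem_filter, not_and, not_forall] at hc
  obtain ⟨t, ht, hh⟩ := hc.2 hc.1
  exact Finset.mem_biUnion.2 ⟨t, ht, Finset.mem_filter.2 ⟨hc.1, hh⟩⟩

/-- boundary sum is small -/
lemma folner_bdry {F : ℕ → Finset G} (hFol : IsFolnerSeq F) (T : Finset G) (s : ℝ) (hs : 0 < s) :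
    ∀ᶠ n in atTop, ∑ t ∈ T, ((((F n).filter fun c => t * c ∉ F n).card : ℝ))
      ≤ s * (F n).card := by
  have h : ∀ᶠ n in atTop, ∀ t ∈ T, ((((F n).filter fun c => t * c ∉ F n).card : ℝ))
      ≤ s / (T.card + 1) * (F n).card := by
    rw [Filter.eventually_all_finset]
    intro t _
    exact folner_tendsto hFol t _ (by positivity)
  filter_upwards [h] with n hn
  refine (Finset.sum_le_card_nsmul _ _ _ hn).trans ?_
  rw [nsmul_eq_mul]
  have : (T.card : ℝ) * (s / (T.card + 1)) ≤ s := by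
    rw [mul_div_assoc', div_le_iff₀ (by positivity)]; nlinarith
  nlinarith [Nat.cast_nonneg (α := ℝ) (F n).card]

lemma folner_intr {F : ℕ → Finset G} (hFol : IsFolnerSeq F) (T : Finset G) (s : ℝ) (hs : 0 < s) :
    ∀ᶠ n in atTop, ((F n).card : ℝ) - s * (F n).card ≤ (intr T (F n)).card := by
  filter_upwards [folner_bdry hFol T s hs] with n hn
  have h1 : ((F n \ intr T (F n)).card : ℝ) ≤
      ∑ t ∈ T, ((((F n).filter fun c => t * c ∉ F n).card : ℝ)) := by
    exact_mod_cast card_sdiff_intr_le T (F n)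
  have h2 : (F n \ intr T (F n)).card + (intr T (F n)).card = (F n).card :=
    Finset.card_sdiff_add_card_eq_card (Finset.filter_subset _ _)
  have h3 : ((F n \ intr T (F n)).card : ℝ) + (intr T (F n)).card = (F n).card := by
    exact_mod_cast h2
  linarith

lemma growth_ge {F : ℕ → Finset G} (hG : GrowthCond F) (B : ℝ) (hB : 0 ≤ B) :
    ∀ᶠ n : ℕ in atTop, B * Real.log (n + 1) + B ≤ (F n).card := by
  have h1 := hG.eventually_ge_atTop (4 * B)
  filter_upwards [h1, eventually_ge_atTop 3] with n hn hn3
  have h3 : (3 : ℝ) ≤ n := by exact_mod_cast hn3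
  have hlog : 1 ≤ Real.log n := by
    rw [Real.le_log_iff_exp_le (by linarith)]
    exact (Real.exp_one_lt_d9.le.trans (by norm_num)).trans h3
  rw [le_div_iff₀ (by linarith)] at hn
  have : Real.log (n + 1) ≤ 2 * Real.log n := by
    rw [← Real.log_rpow (by linarith)]
    apply Real.log_le_log (by linarith)
    norm_num
    nlinarith
  nlinarith

lemma growth_tendsto {F : ℕ → Finset G} (hG : GrowthCond F) :
    Tendsto (fun n => ((F n).card : ℝ)) atTop atTop := by
  rw [tendsto_atTop]
  intro B
  filter_upwards [growth_ge hG |B| (abs_nonneg B)] with n hn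
  have : 0 ≤ Real.log (n + 1) := Real.log_nonneg (by linarith [Nat.cast_nonneg (α := ℝ) n])
  nlinarith [le_abs_self B, abs_nonneg B]

lemma growth_summable {F : ℕ → Finset G} (hG : GrowthCond F) (s : ℝ) (hs : 0 < s) :
    Summable (fun n => Real.exp (-s * (F n).card)) := by
  refine Summable.of_norm_bounded_eventually_nat (g := fun n : ℕ => 1 / ((n : ℝ) + 1) ^ 2) ?_ ?_
  · have := (Real.summable_one_div_nat_pow (p := 2)).2 (by norm_num)
    have := (summable_nat_add_iff 1).2 this
    simpa using this
  · filter_upwards [growth_ge hG (2 / s) (by positivity)] with n hn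
    have hp : (0 : ℝ) < n + 1 := by positivity
    rw [Real.norm_of_nonneg (Real.exp_pos _).le, one_div, ← Real.rpow_natCast,
      ← Real.exp_log (Real.rpow_pos_of_pos hp _), ← Real.exp_neg, Real.exp_le_exp,
      Real.log_rpow hp]
    have h2 : s * (2 / s * Real.log (n + 1) + 2 / s) ≤ s * (F n).card :=
      mul_le_mul_of_nonneg_left hn hs.le
    have h3 : s * (2 / s * Real.log (n + 1) + 2 / s) = 2 * Real.log (n + 1) + 2 := by
      field_simp
    push_cast
    linarith
end Folner

section Maximal
variable {G : Type*} [Group G] [DecidableEq G] {X : Type*} [MeasurableSpace X] [MulAction G X]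
  [MeasurableConstSMul G X]

lemma inv_mp {μ : Measure X} (hinv : InvariantMeasure G μ) (g : G) :
    MeasurePreserving (fun x : X => g • x) μ μ := ⟨measurable_const_smul g, hinv g⟩

lemma sum_tile (S : Finset G) (c : G) (f : G → ℝ) :
    ∑ h ∈ tile S c, f h = ∑ g ∈ S, f (g * c) :=
  Finset.sum_image (fun _ _ _ _ h => mul_left_injective c h)

lemma maximal_ineq_fin {F : ℕ → Finset G} (hFol : IsFolnerSeq F) (C : ℝ) (hC0 : 0 ≤ C)
    (hC : ∀ n : ℕ, (((Finset.range n).biUnion fun k => (F k)⁻¹ * F n).card : ℝ) ≤ C * (F n).card)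
    {μ : Measure X} (hinv : InvariantMeasure G μ)
    (f : X → ℝ) (hf : Measurable f) (hf0 : ∀ x, 0 ≤ f x) (lam : ℝ) (hl : 0 < lam) (M : ℕ) :
    ENNReal.ofReal lam * μ {x | ∃ n < M, lam * (F n).card ≤ ∑ g ∈ F n, f (g • x)} ≤
      ENNReal.ofReal (4 + 4 * C) * ∫⁻ x, ENNReal.ofReal (f x) ∂μ := by
  classical
  set E := {x | ∃ n < M, lam * (F n).card ≤ ∑ g ∈ F n, f (g • x)} with hE
  have hEm : MeasurableSet E := by
    have : E = ⋃ n, ⋃ (_ : n < M), {x | lam * (F n).card ≤ ∑ g ∈ F n, f (g • x)} := by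
      ext x; simp [hE]
    rw [this]
    refine MeasurableSet.iUnion fun n => MeasurableSet.iUnion fun _ => ?_
    exact measurableSet_le measurable_const
      (Finset.measurable_fun_sum _ fun g _ => hf.comp (measurable_const_smul g))
  set T := (Finset.range M).biUnion F with hT
  obtain ⟨N, hN⟩ := (folner_intr hFol T (1 / 2) (by norm_num)).exists
  have hpos : (0 : ℝ) < (F N).card := by exact_mod_cast (hFol.1 N).card_pos
  have hpt : ∀ x, ENNReal.ofReal lam * ∑ c ∈ intr T (F N), E.indicator 1 (c • x) ≤
      ENNReal.ofReal (2 + 2 * C) * ∑ h ∈ F N, ENNReal.ofReal (f (h • x)) := by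
    intro x
    set A := (intr T (F N)).filter fun c => c • x ∈ E with hA
    have hex : ∀ c : G, ∃ n, c • x ∈ E → n < M ∧ lam * (F n).card ≤ ∑ g ∈ F n, f (g • c • x) := by
      intro c
      by_cases h : c • x ∈ E
      · obtain ⟨n, hn⟩ := h
        exact ⟨n, fun _ => hn⟩
      · exact ⟨0, fun h' => absurd h' h⟩
    choose j hj using hex
    obtain ⟨D, hDA, -, hD⟩ := cover F hFol.1 C hC0 hC (1 / 2) (by norm_num) (by norm_num)
      (fun h => f (h • x)) (fun h => hf0 _) lam hl j A (by
        intro c hc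
        rw [sum_tile]
        simpa [mul_smul] using (hj c (Finset.mem_filter.1 hc).2).2)
    have hK : tiles F j D ⊆ F N := by
      intro h hh
      obtain ⟨c, hc, hcc⟩ := mem_tiles.1 hh
      have h1 := Finset.mem_filter.1 (hDA hc)
      have h2 := (Finset.mem_filter.1 h1.1).2 (h * c⁻¹)
        (Finset.mem_biUnion.2 ⟨j c, Finset.mem_range.2 (hj c h1.2).1, hcc⟩)
      simpa using h2
    have h1 : lam * A.card ≤ (2 + 2 * C) * ∑ h ∈ F N, f (h • x) := by
      refine hD.trans ?_
      have h3 : (1 / (1 / 2) + C / (1 - 1 / 2) : ℝ) = 2 + 2 * C := by ring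
      rw [h3]
      exact mul_le_mul_of_nonneg_left (Finset.sum_le_sum_of_subset_of_nonneg hK
        (fun _ _ _ => hf0 _)) (by positivity)
    have h2 : ∑ c ∈ intr T (F N), E.indicator (1 : X → ℝ≥0∞) (c • x) = (A.card : ℝ≥0∞) := by
      simp only [Set.indicator_apply, Pi.one_apply]
      rw [← Finset.sum_filter, ← hA]; simp
    rw [h2, ← ENNReal.ofReal_sum_of_nonneg (fun _ _ => hf0 _),
      ← ENNReal.ofReal_mul (by positivity), ← ENNReal.ofReal_natCast, ← ENNReal.ofReal_mul hl.le]
    exact ENNReal.ofReal_le_ofReal h1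
  have m1 : ∀ c ∈ intr T (F N), Measurable fun x : X => E.indicator (1 : X → ℝ≥0∞) (c • x) :=
    fun c _ => (measurable_one.indicator hEm).comp (measurable_const_smul c)
  have m2 : ∀ c ∈ F N, Measurable fun x : X => ENNReal.ofReal (f (c • x)) :=
    fun c _ => (hf.comp (measurable_const_smul c)).ennreal_ofReal
  have hintl := lintegral_mono (μ := μ) hpt
  rw [lintegral_const_mul' _ _ ENNReal.ofReal_ne_top, lintegral_const_mul' _ _ ENNReal.ofReal_ne_top,
    lintegral_finsetSum _ m1, lintegral_finsetSum _ m2] at hintl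
  have e1 : ∀ c : G, ∫⁻ x, E.indicator (1 : X → ℝ≥0∞) (c • x) ∂μ = μ E := by
    intro c
    rw [(inv_mp hinv c).lintegral_comp (measurable_one.indicator hEm), lintegral_indicator_one hEm]
  have e2 : ∀ c : G, ∫⁻ x, ENNReal.ofReal (f (c • x)) ∂μ = ∫⁻ x, ENNReal.ofReal (f x) ∂μ := by
    intro c
    exact (inv_mp hinv c).lintegral_comp hf.ennreal_ofReal
  simp_rw [e1, e2, Finset.sum_const, nsmul_eq_mul] at hintl
  have h5 : ((F N).card : ℝ≥0∞) ≤ 2 * (intr T (F N)).card := by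
    have : ((F N).card : ℝ) ≤ 2 * (intr T (F N)).card := by linarith
    exact_mod_cast this
  have hn0 : ((F N).card : ℝ≥0∞) ≠ 0 := by
    exact_mod_cast (hFol.1 N).card_pos.ne'
  have h6 : ((F N).card : ℝ≥0∞) * (ENNReal.ofReal lam * μ E) ≤ (F N).card *
      (ENNReal.ofReal (4 + 4 * C) * ∫⁻ x, ENNReal.ofReal (f x) ∂μ) := by
    calc _ ≤ 2 * (intr T (F N)).card * (ENNReal.ofReal lam * μ E) := by gcongr
      _ = 2 * (ENNReal.ofReal lam * ((intr T (F N)).card * μ E)) := by ring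
      _ ≤ 2 * (ENNReal.ofReal (2 + 2 * C) * ((F N).card * ∫⁻ x, ENNReal.ofReal (f x) ∂μ)) := by
        gcongr
      _ = _ := by
        have : ENNReal.ofReal (4 + 4 * C) = 2 * ENNReal.ofReal (2 + 2 * C) := by
          rw [show (2 : ℝ≥0∞) = ENNReal.ofReal 2 by simp, ← ENNReal.ofReal_mul (by norm_num)]
          congr 1; ring
        rw [this]; ring
  exact (ENNReal.mul_le_mul_iff_right hn0 (by simp)).1 h6

lemma maximal_ineq {F : ℕ → Finset G} (hFol : IsFolnerSeq F) (hT : IsTemperedSeq F)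
    {μ : Measure X} (hinv : InvariantMeasure G μ) :
    ∃ C : ℝ, 0 ≤ C ∧ ∀ (f : X → ℝ) (_ : Measurable f) (_ : ∀ x, 0 ≤ f x) (lam : ℝ) (_ : 0 < lam),
    ENNReal.ofReal lam * μ {x | ∃ n, lam * (F n).card ≤ ∑ g ∈ F n, f (g • x)} ≤
      ENNReal.ofReal C * ∫⁻ x, ENNReal.ofReal (f x) ∂μ := by
  obtain ⟨C, hC⟩ := hT
  refine ⟨4 + 4 * max C 0, by positivity, ?_⟩
  intro f hf hf0 lam hl
  have hC' : ∀ n : ℕ, (((Finset.range n).biUnion fun k => (F k)⁻¹ * F n).card : ℝ)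
      ≤ max C 0 * (F n).card := fun n => (hC n).trans (by gcongr; exact le_max_left _ _)
  have hU : {x | ∃ n, lam * (F n).card ≤ ∑ g ∈ F n, f (g • x)} =
      ⋃ M : ℕ, {x | ∃ n < M, lam * (F n).card ≤ ∑ g ∈ F n, f (g • x)} := by
    ext x
    simp only [mem_setOf_eq, mem_iUnion]
    constructor
    · rintro ⟨n, hn⟩; exact ⟨n + 1, n, by omega, hn⟩
    · rintro ⟨_, n, _, hn⟩; exact ⟨n, hn⟩
  rw [hU, Monotone.measure_iUnion, ENNReal.mul_iSup]
  · exact iSup_le fun M => maximal_ineq_fin hFol _ (le_max_right _ _) hC' hinv f hf hf0 lam hl M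
  · intro a b hab x
    rintro ⟨n, hn, h⟩
    exact ⟨n, by omega, h⟩
end Maximal

section PET
variable {G : Type*} [Group G] [DecidableEq G] {X : Type*} [MeasurableSpace X] [MulAction G X]

/-- ergodic average -/
noncomputable def avg (F : ℕ → Finset G) (φ : X → ℝ) (n : ℕ) (x : X) : ℝ :=
  (∑ g ∈ F n, φ (g • x)) / (F n).card

variable [MeasurableConstSMul G X]

lemma ae_all_smul [Countable G] {μ : Measure X} (hinv : InvariantMeasure G μ) {p : X → Prop}
    (hp : ∀ᵐ x ∂μ, p x) : ∀ᵐ x ∂μ, ∀ g : G, p (g • x) := by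
  rw [ae_all_iff]
  intro g
  exact (inv_mp hinv g).quasiMeasurePreserving.ae hp

lemma conv_zero_of_approx {F : ℕ → Finset G} (hFol : IsFolnerSeq F) (hT : IsTemperedSeq F)
    {μ : Measure X} (hinv : InvariantMeasure G μ) (φ : X → ℝ) (hφ : Measurable φ)
    (h : ∀ ε : ℝ, 0 < ε → ∃ ψ : X → ℝ, Measurable ψ ∧
      (∀ᵐ x ∂μ, Tendsto (fun n => avg F ψ n x) atTop (𝓝 0)) ∧
      ∫⁻ x, ENNReal.ofReal |φ x - ψ x| ∂μ ≤ ENNReal.ofReal ε) :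
    ∀ᵐ x ∂μ, Tendsto (fun n => avg F φ n x) atTop (𝓝 0) := by
  obtain ⟨C, hC0, hC⟩ := maximal_ineq hFol hT hinv
  have key : ∀ m : ℕ, ∀ᵐ x ∂μ, ∀ᶠ n in atTop, |avg F φ n x| < 2 / ((m : ℝ) + 1) := by
    intro m
    set lam : ℝ := 1 / ((m : ℝ) + 1) with hlam
    have hl : 0 < lam := by positivity
    rw [ae_iff]
    by_contra hne
    set B := {x | ¬ ∀ᶠ n in atTop, |avg F φ n x| < 2 / ((m : ℝ) + 1)} with hB
    have hle : ∀ ε : ℝ, 0 < ε → ENNReal.ofReal lam * μ B ≤ ENNReal.ofReal (C * ε) := by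
      intro ε hε
      obtain ⟨ψ, hψ, hconv, hintl⟩ := h ε hε
      have h1 := hC (fun x => |φ x - ψ x|) (hφ.sub hψ).abs (fun x => abs_nonneg _) lam hl
      have h2 : μ B ≤ μ {x | ∃ n, lam * (F n).card ≤ ∑ g ∈ F n, |φ (g • x) - ψ (g • x)|} := by
        apply measure_mono_ae
        filter_upwards [hconv] with x hx hxB
        by_contra hno
        apply hxB
        have hno' : ∀ n, ∑ g ∈ F n, |φ (g • x) - ψ (g • x)| < lam * (F n).card := by
          intro n
          by_contra hh
          exact hno ⟨n, not_lt.1 hh⟩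
        have h3 : ∀ᶠ n in atTop, |avg F ψ n x| < lam := by
          have := hx.abs
          rw [abs_zero] at this
          exact this.eventually (gt_mem_nhds hl)
        filter_upwards [h3] with n hn
        have hpos : (0 : ℝ) < (F n).card := by exact_mod_cast (hFol.1 n).card_pos
        have h4 : |avg F φ n x - avg F ψ n x| < lam := by
          unfold avg
          rw [← sub_div, ← Finset.sum_sub_distrib, abs_div, abs_of_pos hpos, div_lt_iff₀ hpos]
          exact (Finset.abs_sum_le_sum_abs _ _).trans_lt (hno' n)
        have h5 : |avg F φ n x| ≤ |avg F φ n x - avg F ψ n x| + |avg F ψ n x| := by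
          have := abs_add_le (avg F φ n x - avg F ψ n x) (avg F ψ n x)
          simpa using this
        have h6 : 2 / ((m : ℝ) + 1) = lam + lam := by rw [hlam]; ring
        rw [h6]; linarith
      calc ENNReal.ofReal lam * μ B ≤ _ := mul_le_mul_right h2 _
        _ ≤ _ := h1
        _ ≤ ENNReal.ofReal C * ENNReal.ofReal ε := mul_le_mul_right hintl _
        _ = _ := (ENNReal.ofReal_mul hC0).symm
    have hpos : 0 < ENNReal.ofReal lam * μ B :=
      ENNReal.mul_pos (by simpa using hl) hne
    have hlim : Tendsto (fun ε : ℝ => ENNReal.ofReal (C * ε)) (𝓝[>] 0) (𝓝 0) := by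
      have : Tendsto (fun ε : ℝ => ENNReal.ofReal (C * ε)) (𝓝 0) (𝓝 (ENNReal.ofReal (C * 0))) :=
        (ENNReal.continuous_ofReal.comp (continuous_const.mul continuous_id)).tendsto 0
      simp only [mul_zero, ENNReal.ofReal_zero] at this
      exact this.mono_left nhdsWithin_le_nhds
    have := ge_of_tendsto hlim (by
      filter_upwards [self_mem_nhdsWithin] with ε hε
      exact hle ε hε)
    exact absurd this (not_le.2 hpos)
  rw [← ae_all_iff] at key
  filter_upwards [key] with x hx
  rw [Metric.tendsto_atTop']
  intro ε hε
  obtain ⟨m, hm⟩ := exists_nat_gt (2 / ε)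
  obtain ⟨N, hN⟩ := eventually_atTop.1 (hx m)
  refine ⟨N, fun n hn => ?_⟩
  rw [Real.dist_eq, sub_zero]
  refine (hN n hn.le).trans_le ?_
  rw [div_le_iff₀ (by positivity)]
  rw [div_lt_iff₀ hε] at hm
  nlinarith

lemma avg_add (F : ℕ → Finset G) (φ ψ : X → ℝ) (n : ℕ) (x : X) :
    avg F (fun y => φ y + ψ y) n x = avg F φ n x + avg F ψ n x := by
  simp [avg, Finset.sum_add_distrib, add_div]

lemma avg_congr_ae [Countable G] {μ : Measure X} (hinv : InvariantMeasure G μ) (F : ℕ → Finset G)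
    {φ ψ : X → ℝ} (h : φ =ᵐ[μ] ψ) : ∀ᵐ x ∂μ, ∀ n, avg F φ n x = avg F ψ n x := by
  filter_upwards [ae_all_smul hinv h] with x hx n
  simp only [avg]
  rw [Finset.sum_congr rfl fun g _ => hx g]

lemma avg_cobdry {F : ℕ → Finset G} (hFol : IsFolnerSeq F) (φ : X → ℝ) (b : ℝ)
    (hb : ∀ x, |φ x| ≤ b) (t : G) (x : X) :
    Tendsto (fun n => avg F (fun y => φ y - φ (t • y)) n x) atTop (𝓝 0) := by
  have h := (hFol.2 t).mul_const b
  rw [zero_mul] at h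
  apply squeeze_zero_norm _ h
  intro n
  have hpos : (0 : ℝ) < (F n).card := by exact_mod_cast (hFol.1 n).card_pos
  rw [Real.norm_eq_abs, avg, abs_div, abs_of_pos hpos, div_mul_eq_mul_div]
  apply div_le_div_of_nonneg_right _ hpos.le
  have h2 : ∑ g ∈ F n, φ (t • g • x) = ∑ g ∈ (F n).image (t * ·), φ (g • x) := by
    rw [Finset.sum_image (fun _ _ _ _ h => mul_right_injective t h)]
    simp [mul_smul]
  rw [Finset.sum_sub_distrib, h2]
  set A := F n
  set B := (F n).image (t * ·)
  have e1 := Finset.sum_inter_add_sum_sdiff A B (fun g => φ (g • x))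
  have e2 := Finset.sum_inter_add_sum_sdiff B A (fun g => φ (g • x))
  rw [Finset.inter_comm] at e2
  have e3 : |∑ g ∈ A \ B, φ (g • x)| ≤ (A \ B).card * b := by
    refine (Finset.abs_sum_le_sum_abs _ _).trans ?_
    rw [← nsmul_eq_mul]
    exact Finset.sum_le_card_nsmul _ _ _ (fun g _ => hb _)
  have e4 : |∑ g ∈ B \ A, φ (g • x)| ≤ (B \ A).card * b := by
    refine (Finset.abs_sum_le_sum_abs _ _).trans ?_
    rw [← nsmul_eq_mul]
    exact Finset.sum_le_card_nsmul _ _ _ (fun g _ => hb _)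
  have e5 : ((symmDiff A B).card : ℝ) = (A \ B).card + (B \ A).card := by
    rw [symmDiff_def, Finset.sup_eq_union, Finset.card_union_of_disjoint]
    · push_cast; rfl
    · exact disjoint_sdiff_sdiff
  rw [e5, ← e1, ← e2, add_mul]
  have : ∑ g ∈ A ∩ B, φ (g • x) + ∑ g ∈ A \ B, φ (g • x) -
      (∑ g ∈ A ∩ B, φ (g • x) + ∑ g ∈ B \ A, φ (g • x)) =
      ∑ g ∈ A \ B, φ (g • x) - ∑ g ∈ B \ A, φ (g • x) := by ring
  rw [this]
  refine (abs_sub _ _).trans (add_le_add e3 e4)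

lemma exists_strict_invariant [Countable G] {μ : Measure X} (hinv : InvariantMeasure G μ)
    (f : X → ℝ) (hf : Measurable f) (h : ∀ g : G, ∀ᵐ x ∂μ, f (g • x) = f x) :
    ∃ f' : X → ℝ, Measurable f' ∧ (∀ (g : G) x, f' (g • x) = f' x) ∧ f' =ᵐ[μ] f := by
  classical
  set Ω := {x | ∀ g : G, f (g • x) = f x} with hΩ
  have hm : MeasurableSet Ω := by
    have : Ω = ⋂ g : G, {x | f (g • x) = f x} := by ext; simp [hΩ]
    rw [this]
    exact MeasurableSet.iInter fun g =>
      measurableSet_eq_fun (hf.comp (measurable_const_smul g)) hf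
  have hI : ∀ (g : G) x, g • x ∈ Ω ↔ x ∈ Ω := by
    have h1 : ∀ (g : G) x, x ∈ Ω → g • x ∈ Ω := by
      intro g x hx g'
      have e1 := hx (g' * g)
      rw [mul_smul] at e1
      rw [e1, hx g]
    intro g x
    refine ⟨fun hx => ?_, h1 g x⟩
    have := h1 g⁻¹ _ hx
    simpa using this
  refine ⟨Ω.indicator f, hf.indicator hm, ?_, ?_⟩
  · intro g x
    by_cases hx : x ∈ Ω
    · rw [indicator_of_mem hx, indicator_of_mem ((hI g x).2 hx), hx g]
    · rw [indicator_of_notMem hx, indicator_of_notMem (fun h' => hx ((hI g x).1 h'))]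
  · filter_upwards [ae_all_iff.2 h] with x hx
    exact indicator_of_mem (show x ∈ Ω from hx) f

theorem pet [Countable G] {F : ℕ → Finset G} (hFol : IsFolnerSeq F) (hT : IsTemperedSeq F)
    {μ : Measure X} [IsProbabilityMeasure μ] (hinv : InvariantMeasure G μ)
    (f : X → ℝ) (hf : Measurable f) (b : ℝ) (hb : ∀ x, |f x| ≤ b) :
    ∃ fb : X → ℝ, Measurable fb ∧ (∀ (g : G) x, fb (g • x) = fb x) ∧
      (∀ᵐ x ∂μ, Tendsto (fun n => avg F f n x) atTop (𝓝 (fb x))) ∧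
      (∀ᵐ x ∂μ, |fb x| ≤ b) ∧ ∫ x, fb x ∂μ = ∫ x, f x ∂μ := by
  let U : G → (Lp ℝ 2 μ →ₗᵢ[ℝ] Lp ℝ 2 μ) := fun g =>
    Lp.compMeasurePreservingₗᵢ ℝ (fun x : X => g • x) (inv_mp hinv g)
  have hU : ∀ g (u : Lp ℝ 2 μ), U g u =ᵐ[μ] fun x => u (g • x) := fun g u =>
    Lp.coeFn_compMeasurePreserving u (inv_mp hinv g)
  let Z : Submodule ℝ (Lp ℝ 2 μ) :=
    { carrier := {w | ∀ᵐ x ∂μ, Tendsto (fun n => avg F (w : X → ℝ) n x) atTop (𝓝 0)}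
      zero_mem' := by
        filter_upwards [avg_congr_ae hinv F (Lp.coeFn_zero ℝ 2 μ)] with x hx
        simp_rw [hx]
        simp [avg]
      add_mem' := by
        intro u v hu hv
        have hu : ∀ᵐ x ∂μ, Tendsto (fun n => avg F (u : X → ℝ) n x) atTop (𝓝 0) := hu
        have hv : ∀ᵐ x ∂μ, Tendsto (fun n => avg F (v : X → ℝ) n x) atTop (𝓝 0) := hv
        change ∀ᵐ x ∂μ, Tendsto (fun n => avg F ((u + v : Lp ℝ 2 μ) : X → ℝ) n x) atTop (𝓝 0)
        filter_upwards [avg_congr_ae hinv F (Lp.coeFn_add u v), hu, hv] with x hx h1 h2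
        simp_rw [hx]
        have := h1.add h2
        rw [add_zero] at this
        refine this.congr fun n => (avg_add F u v n x).symm
      smul_mem' := by
        intro c u hu
        have hu : ∀ᵐ x ∂μ, Tendsto (fun n => avg F (u : X → ℝ) n x) atTop (𝓝 0) := hu
        change ∀ᵐ x ∂μ, Tendsto (fun n => avg F ((c • u : Lp ℝ 2 μ) : X → ℝ) n x) atTop (𝓝 0)
        filter_upwards [avg_congr_ae hinv F (Lp.coeFn_smul c u), hu] with x hx h1
        simp_rw [hx]
        have := h1.const_mul c
        rw [mul_zero] at this
        refine this.congr fun n => ?_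
        simp [avg, ← Finset.mul_sum, mul_div_assoc] }
  have hZ : ∀ w, w ∈ Z ↔ ∀ᵐ x ∂μ, Tendsto (fun n => avg F (w : X → ℝ) n x) atTop (𝓝 0) :=
    fun w => Iff.rfl
  have hZc : IsClosed (Z : Set (Lp ℝ 2 μ)) := by
    apply isClosed_of_closure_subset
    intro w hw
    refine (hZ w).2 (conv_zero_of_approx hFol hT hinv w (Lp.stronglyMeasurable w).measurable ?_)
    intro ε hε
    obtain ⟨z, hz, hd⟩ := Metric.mem_closure_iff.1 hw ε hε
    refine ⟨z, (Lp.stronglyMeasurable z).measurable, hz, ?_⟩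
    have e1 : ∫⁻ x, ENNReal.ofReal |w x - z x| ∂μ = eLpNorm (w - z : Lp ℝ 2 μ) 1 μ := by
      rw [eLpNorm_one_eq_lintegral_enorm]
      apply lintegral_congr_ae
      filter_upwards [Lp.coeFn_sub w z] with x hx
      rw [hx, Pi.sub_apply, Real.enorm_eq_ofReal_abs]
    rw [e1]
    refine (eLpNorm_le_eLpNorm_of_exponent_le (q := 2) (by norm_num)
      (Lp.aestronglyMeasurable _)).trans ?_
    rw [← Lp.enorm_def, ← ofReal_norm_eq_enorm, ← dist_eq_norm]
    exact ENNReal.ofReal_le_ofReal hd.le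
  have hcob : ∀ (g : G) (u : Lp ℝ 2 μ), u - U g u ∈ Z := by
    intro g u
    induction u using Lp.induction (by norm_num : (2 : ℝ≥0∞) ≠ ⊤) with
    | indicatorConst c hs hμs =>
      rename_i s
      rw [hZ]
      have h0 : (Lp.simpleFunc.indicatorConst 2 hs hμs.ne c : Lp ℝ 2 μ) =ᵐ[μ]
          s.indicator fun _ => c := by
        rw [Lp.simpleFunc.coe_indicatorConst]
        exact indicatorConstLp_coeFn
      set u : Lp ℝ 2 μ := (Lp.simpleFunc.indicatorConst 2 hs hμs.ne c : Lp ℝ 2 μ)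
      have h1 : (u - U g u : Lp ℝ 2 μ) =ᵐ[μ]
          fun y => s.indicator (fun _ => c) y - s.indicator (fun _ => c) (g • y) := by
        filter_upwards [Lp.coeFn_sub u (U g u), hU g u, h0, ae_all_smul hinv h0] with x a1 a2 a3 a4
        rw [a1, Pi.sub_apply, a2, a3, a4 g]
      filter_upwards [avg_congr_ae hinv F h1] with x hx
      simp_rw [hx]
      refine avg_cobdry hFol (s.indicator fun _ => c) |c| (fun y => ?_) g x
      by_cases hy : y ∈ s <;> simp [hy]
    | add hu hv hd h1 h2 =>
      rw [map_add, add_sub_add_comm]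
      exact Z.add_mem h1 h2
    | isClosed =>
      exact hZc.preimage (continuous_id.sub (U g).continuous)
  let W : Submodule ℝ (Lp ℝ 2 μ) := (Submodule.span ℝ {w | ∃ g u, w = u - U g u}).topologicalClosure
  have hWZ : W ≤ Z := by
    apply Submodule.topologicalClosure_minimal _ _ hZc
    rw [Submodule.span_le]
    rintro w ⟨g, u, rfl⟩
    exact hcob g u
  have hfm : MemLp f 2 μ := MemLp.of_bound hf.aestronglyMeasurable b (ae_of_all _ hb)
  set f2 := hfm.toLp f with hf2
  have : CompleteSpace W := (Submodule.isClosed_topologicalClosure _).completeSpace_coe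
  obtain ⟨q, hq, p, hp, hqp⟩ := W.exists_add_mem_mem_orthogonal f2
  have hpinv : ∀ g, U g p = p := by
    intro g
    have h1 : inner ℝ (p - U g p) p = 0 := hp _ (Submodule.le_topologicalClosure _
      (Submodule.subset_span ⟨g, p, rfl⟩))
    have h2 : ‖U g p - p‖ ^ 2 = 0 := by
      rw [norm_sub_sq_real, (U g).norm_map]
      rw [inner_sub_left, real_inner_self_eq_norm_sq] at h1
      linarith
    rw [sq_eq_zero_iff, norm_eq_zero, sub_eq_zero] at h2
    exact h2
  obtain ⟨fb, hfbm, hfbi, hfbe⟩ := exists_strict_invariant hinv (p : X → ℝ)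
    (Lp.stronglyMeasurable p).measurable (fun g => by
      have := hU g p
      rw [hpinv g] at this
      filter_upwards [this] with x hx
      exact hx.symm)
  have hsum : f =ᵐ[μ] fun x => q x + fb x := by
    filter_upwards [hfm.coeFn_toLp, hfbe, Lp.coeFn_add q p] with x h1 h2 h3
    rw [← h1, ← hf2, hqp, h3, h2]; rfl
  have hconv : ∀ᵐ x ∂μ, Tendsto (fun n => avg F f n x) atTop (𝓝 (fb x)) := by
    filter_upwards [avg_congr_ae hinv F hsum, (hZ q).1 (hWZ hq)] with x h1 h2
    simp_rw [h1, avg_add]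
    have h3 : ∀ n, avg F fb n x = fb x := by
      intro n
      have hpos : (0 : ℝ) < (F n).card := by exact_mod_cast (hFol.1 n).card_pos
      simp only [avg, hfbi, Finset.sum_const, nsmul_eq_mul]
      field_simp
    simp_rw [h3]
    simpa using h2.add_const (fb x)
  have hbd : ∀ n x, |avg F f n x| ≤ b := by
    intro n x
    have hpos : (0 : ℝ) < (F n).card := by exact_mod_cast (hFol.1 n).card_pos
    rw [avg, abs_div, abs_of_pos hpos, div_le_iff₀ hpos]
    refine (Finset.abs_sum_le_sum_abs _ _).trans ?_
    rw [mul_comm, ← nsmul_eq_mul]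
    exact Finset.sum_le_card_nsmul _ _ _ (fun g _ => hb _)
  refine ⟨fb, hfbm, hfbi, hconv, ?_, ?_⟩
  · filter_upwards [hconv] with x hx
    exact le_of_tendsto hx.abs (Eventually.of_forall fun n => hbd n x)
  · have hlim : Tendsto (fun n => ∫ x, avg F f n x ∂μ) atTop (𝓝 (∫ x, fb x ∂μ)) := by
      refine tendsto_integral_of_dominated_convergence (fun _ => b) (fun n => ?_)
        (integrable_const b) (fun n => ae_of_all _ (hbd n)) hconv
      unfold avg
      exact ((Finset.measurable_fun_sum _ fun g _ =>
        hf.comp (measurable_const_smul g)).div_const _).aestronglyMeasurable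
    have hconst : ∀ n, ∫ x, avg F f n x ∂μ = ∫ x, f x ∂μ := by
      intro n
      have hpos : (0 : ℝ) < (F n).card := by exact_mod_cast (hFol.1 n).card_pos
      have hfi : Integrable f μ := hfm.integrable (by norm_num)
      have h1 : ∀ g : G, ∫ x, f (g • x) ∂μ = ∫ x, f x ∂μ := by
        intro g
        have := integral_map (μ := μ) (measurable_const_smul g).aemeasurable
          (f := f) (by rw [hinv g]; exact hf.aestronglyMeasurable)
        rw [hinv g] at this
        exact this.symm
      have m : ∀ g ∈ F n, Integrable (fun x => f (g • x)) μ := fun g _ =>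
        ((inv_mp hinv g).integrable_comp hf.aestronglyMeasurable).2 hfi
      simp only [avg]
      rw [integral_div, integral_finset_sum _ m]
      simp_rw [h1, Finset.sum_const, nsmul_eq_mul]
      field_simp
    simp_rw [hconst] at hlim
    exact tendsto_nhds_unique hlim tendsto_const_nhds
end PET

section Finner

lemma finner_lmarginal {V ι A : Type*} [Fintype V] [DecidableEq V] [MeasurableSpace A]
    (ρ : V → Measure A) [∀ v, IsProbabilityMeasure (ρ v)]
    (s : Finset ι) (S : ι → Set V) (w : ι → ℝ) (hw : ∀ i ∈ s, 0 ≤ w i)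
    (hsum : ∀ v, ∀ s' ⊆ s, (∀ i ∈ s', v ∈ S i) → ∑ i ∈ s', w i ≤ 1)
    (f : ι → (V → A) → ℝ≥0∞) (hf : ∀ i, Measurable (f i))
    (hdep : ∀ i ∈ s, ∀ ω ω' : V → A, (∀ v ∈ S i, ω v = ω' v) → f i ω = f i ω')
    (t : Finset V) (x : V → A) :
    (∫⋯∫⁻_t, (fun ω => ∏ i ∈ s, f i ω ^ w i) ∂ρ) x ≤ ∏ i ∈ s, ((∫⋯∫⁻_t, f i ∂ρ) x) ^ w i := by
  classical
  induction t using Finset.induction_on generalizing x with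
  | empty => simp
  | insert v t hv ih =>
    have hm : Measurable (fun ω => ∏ i ∈ s, f i ω ^ w i) := by
      apply Finset.measurable_fun_prod
      intro i _
      exact (hf i).pow_const _
    rw [lmarginal_insert _ hm hv]
    set g : ι → (V → A) → ℝ≥0∞ := fun i => ∫⋯∫⁻_t, f i ∂ρ with hg
    have hgm : ∀ i, Measurable fun a => g i (Function.update x v a) := fun i =>
      ((hf i).lmarginal ρ).comp (measurable_update x)
    have hI : ∀ i, (∫⋯∫⁻_insert v t, f i ∂ρ) x = ∫⁻ a, g i (Function.update x v a) ∂ρ v :=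
      fun i => lmarginal_insert _ (hf i) hv x
    simp_rw [hI]
    refine (lintegral_mono fun a => ih (Function.update x v a)).trans ?_
    have hconst : ∀ i ∈ s, v ∉ S i → ∀ a, g i (Function.update x v a) = g i x := by
      intro i hi hvi a
      simp only [hg, lmarginal]
      refine lintegral_congr fun y => hdep i hi _ _ fun u hu => ?_
      simp only [Function.updateFinset]
      split_ifs
      · rfl
      · rw [Function.update_of_ne]
        rintro rfl; exact hvi hu
    set s1 := s.filter fun i => v ∈ S i with hs1
    set s2 := s.filter fun i => ¬ v ∈ S i with hs2
    have hsplit : ∀ q : ι → ℝ≥0∞, ∏ i ∈ s, q i = (∏ i ∈ s1, q i) * ∏ i ∈ s2, q i := fun q =>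
      (Finset.prod_filter_mul_prod_filter_not s _ q).symm
    have h2 : ∀ a, ∏ i ∈ s, g i (Function.update x v a) ^ w i
        = (∏ i ∈ s1, g i (Function.update x v a) ^ w i) * ∏ i ∈ s2, g i x ^ w i := by
      intro a
      rw [hsplit]
      congr 1
      refine Finset.prod_congr rfl fun i hi => ?_
      rw [Finset.mem_filter] at hi
      rw [hconst i hi.1 hi.2]
    have h3 : ∏ i ∈ s, (∫⁻ a, g i (Function.update x v a) ∂ρ v) ^ w i
        = (∏ i ∈ s1, (∫⁻ a, g i (Function.update x v a) ∂ρ v) ^ w i) * ∏ i ∈ s2, g i x ^ w i := by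
      rw [hsplit]
      congr 1
      refine Finset.prod_congr rfl fun i hi => ?_
      rw [Finset.mem_filter] at hi
      simp_rw [hconst i hi.1 hi.2]
      simp
    change ∫⁻ a, ∏ i ∈ s, g i (Function.update x v a) ^ w i ∂ρ v ≤ _
    simp_rw [h2]
    rw [h3, lintegral_mul_const _ (Finset.measurable_fun_prod _ fun i _ => (hgm i).pow_const _)]
    gcongr
    have hle : ∑ i ∈ s1, w i ≤ 1 := hsum v s1 (Finset.filter_subset _ _)
      (fun i hi => (Finset.mem_filter.1 hi).2)
    have := ENNReal.lintegral_mul_prod_norm_pow_le (μ := ρ v) s1 (g := fun _ => 1)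
      (f := fun i a => g i (Function.update x v a)) aemeasurable_const
      (fun i _ => (hgm i).aemeasurable) (1 - ∑ i ∈ s1, w i) (p := w) (by ring) (by linarith)
      (fun i hi => hw i (Finset.mem_filter.1 hi).1)
    simpa using this

lemma finner {V ι A : Type*} [Fintype V] [MeasurableSpace A] [Nonempty A]
    (ρ : V → Measure A) [∀ v, IsProbabilityMeasure (ρ v)]
    (s : Finset ι) (S : ι → Set V) (w : ι → ℝ) (hw : ∀ i ∈ s, 0 ≤ w i)
    (hsum : ∀ v, ∀ s' ⊆ s, (∀ i ∈ s', v ∈ S i) → ∑ i ∈ s', w i ≤ 1)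
    (f : ι → (V → A) → ℝ≥0∞) (hf : ∀ i, Measurable (f i))
    (hdep : ∀ i ∈ s, ∀ ω ω' : V → A, (∀ v ∈ S i, ω v = ω' v) → f i ω = f i ω')
    (hI : ∀ i ∈ s, ∫⁻ ω, f i ω ∂Measure.pi ρ ≤ 1) :
    ∫⁻ ω, ∏ i ∈ s, f i ω ^ w i ∂Measure.pi ρ ≤ 1 := by
  classical
  have x : V → A := fun _ => Classical.arbitrary A
  have h := finner_lmarginal ρ s S w hw hsum f hf hdep Finset.univ x
  rw [← lintegral_eq_lmarginal_univ x] at h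
  refine h.trans (Finset.prod_le_one' fun i hi => ?_)
  rw [← lintegral_eq_lmarginal_univ x]
  exact (ENNReal.rpow_le_rpow (hI i hi) (hw i hi)).trans (by simp)

lemma map_comp_pi {V T A : Type*} [Fintype V] [Fintype T] [MeasurableSpace A]
    (ρ : Measure A) [IsProbabilityMeasure ρ] (e : T → V) (he : Function.Injective e) :
    (Measure.pi fun _ : V => ρ).map (fun ω => fun t => ω (e t)) = Measure.pi fun _ : T => ρ := by
  classical
  symm
  apply Measure.pi_eq
  intro s hs
  have hmeas : Measurable (fun ω : V → A => fun t => ω (e t)) :=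
    measurable_pi_lambda _ fun t => measurable_pi_apply _
  rw [Measure.map_apply hmeas (MeasurableSet.univ_pi hs)]
  have : (fun ω : V → A => fun t => ω (e t)) ⁻¹' (univ.pi s)
      = univ.pi fun v => ⋂ t : {t // e t = v}, s t.1 := by
    ext ω
    simp only [mem_preimage, Set.mem_pi, mem_univ, true_imp_iff, mem_iInter]
    constructor
    · rintro h v ⟨t, rfl⟩; exact h t
    · intro h t; exact h (e t) ⟨t, rfl⟩
  rw [this, Measure.pi_pi]
  rw [← Finset.prod_subset (Finset.subset_univ (Finset.univ.image e))]
  · rw [Finset.prod_image fun a _ b _ h => he h]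
    refine Finset.prod_congr rfl fun t _ => ?_
    congr 1
    ext a
    simp only [mem_iInter]
    constructor
    · intro h; exact h ⟨t, rfl⟩
    · rintro h ⟨t', ht'⟩
      obtain rfl := he ht'
      exact h
  · intro v _ hv
    have : IsEmpty {t // e t = v} := ⟨fun t => hv (Finset.mem_image.2 ⟨t.1, Finset.mem_univ _, t.2⟩)⟩
    simp

end Finner

section Coder

/-- uniform measure -/
noncomputable def unif (k : ℕ) : Measure (Fin k) := (k : ℝ≥0∞)⁻¹ • Measure.count

lemma unif_prob {k : ℕ} (hk : 0 < k) : IsProbabilityMeasure (unif k) := by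
  constructor
  have h0 : (k : ℝ≥0∞) ≠ 0 := by exact_mod_cast hk.ne'
  simp only [unif, Measure.smul_apply, smul_eq_mul, Measure.count_univ]
  simp [ENNReal.inv_mul_cancel h0 (ENNReal.natCast_ne_top k)]

lemma lint_unif {k : ℕ} (hk : 0 < k) {V : Type*} [Fintype V] [DecidableEq V] (f : (V → Fin k) → ℝ≥0∞) :
    ∫⁻ ω, f ω ∂Measure.pi (fun _ : V => unif k)
      = (∑ ω, f ω) * ((k : ℝ≥0∞)⁻¹) ^ (Fintype.card V) := by
  haveI := unif_prob hk
  rw [lintegral_fintype, Finset.sum_mul]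
  refine Finset.sum_congr rfl fun ω _ => ?_
  rw [Measure.pi_singleton]
  congr 1
  simp [unif]

lemma int_le_one {k : ℕ} (hk : 0 < k) {V T : Type*} [Fintype V] [Fintype T] [DecidableEq T]
    (m : (T → Fin k) → ℝ) (hm : ∀ u, 0 ≤ m u) (hs : ∑ u, m u ≤ 1) (e : T → V)
    (he : Function.Injective e) :
    ∫⁻ ω, ENNReal.ofReal (m (fun t => ω (e t)) * (k : ℝ) ^ (Fintype.card T))
      ∂Measure.pi (fun _ : V => unif k) ≤ 1 := by
  haveI := unif_prob hk
  have h := lintegral_map (μ := Measure.pi (fun _ : V => unif k))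
    (f := fun u : T → Fin k => ENNReal.ofReal (m u * (k : ℝ) ^ (Fintype.card T)))
    (g := fun ω => fun t => ω (e t)) (measurable_of_countable _) (measurable_of_countable _)
  rw [← h, map_comp_pi (unif k) e he, lint_unif hk, Finset.sum_mul]
  have h0 : (k : ℝ≥0∞) ≠ 0 := by exact_mod_cast hk.ne'
  have : ∀ u : T → Fin k, ENNReal.ofReal (m u * (k : ℝ) ^ (Fintype.card T))
      * ((k : ℝ≥0∞)⁻¹) ^ (Fintype.card T) = ENNReal.ofReal (m u) := by
    intro u
    rw [ENNReal.ofReal_mul (hm u), mul_assoc, ENNReal.ofReal_pow (by positivity),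
      ENNReal.ofReal_natCast, ← mul_pow, ENNReal.mul_inv_cancel h0 (ENNReal.natCast_ne_top k)]
    simp
  simp_rw [this]
  rw [← ENNReal.ofReal_sum_of_nonneg fun u _ => hm u]
  exact ENNReal.ofReal_le_one.2 hs

variable {G : Type*} [Group G] [DecidableEq G]

/-- extension of a word on `S` by a constant -/
def xt {A : Type*} (S : Finset G) (a0 : A) (ω : ↥S → A) (g : G) : A :=
  if h : g ∈ S then ω ⟨g, h⟩ else a0

lemma ofReal_rpow_exp {y p : ℝ} (hy : 0 < y) :
    ENNReal.ofReal y ^ p = ENNReal.ofReal (Real.exp (p * Real.log y)) := by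
  rw [ENNReal.ofReal_rpow_of_pos hy, Real.rpow_def_of_pos hy, mul_comm]

theorem coder {k : ℕ} (hk : 0 < k) (a0 : Fin k) (S K Q T : Finset G) (hT : T.Nonempty)
    (hK : K ⊆ S) (hQ : ∀ c ∈ Q, ∀ t ∈ T, t * c ∈ S ∧ t * c ∉ K)
    (m : (↥T → Fin k) → ℝ) (hm : ∀ u, 0 < m u) (hms : ∑ u, m u ≤ 1)
    (r : G → Fin k → ℝ) (hr : ∀ h a, 0 < r h a) (hrs : ∀ h, ∑ a, r h a ≤ 1) :
    ∑ ω : ↥S → Fin k, Real.exp ((∑ c ∈ Q, Real.log (m fun t => xt S a0 ω (t * c))) / T.card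
      + ∑ h ∈ K, Real.log (r h (xt S a0 ω h))
      - ((S.card : ℝ) - Q.card - K.card) * Real.log k) ≤ 1 := by
  classical
  haveI := unif_prob hk
  haveI : Nonempty (Fin k) := ⟨a0⟩
  have hTpos : (0 : ℝ) < T.card := by exact_mod_cast hT.card_pos
  have hk0 : (0 : ℝ) < k := by exact_mod_cast hk
  let f : G ⊕ G → (↥S → Fin k) → ℝ≥0∞ := fun i ω =>
    Sum.elim (fun c => ENNReal.ofReal (m (fun t => xt S a0 ω (t * c)) * (k : ℝ) ^ T.card))
      (fun h => ENNReal.ofReal (r h (xt S a0 ω h) * (k : ℝ))) i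
  let w : G ⊕ G → ℝ := Sum.elim (fun _ => (1 / T.card : ℝ)) (fun _ => 1)
  let SS : G ⊕ G → Set ↥S := Sum.elim (fun c => {v | (v : G) ∈ tile T c}) (fun h => {v | (v : G) = h})
  have key := finner (fun _ : ↥S => unif k) (Q.disjSum K) SS w ?_ ?_ f
    (fun i => measurable_of_countable _) ?_ ?_
  · rw [lint_unif hk] at key
    have e : ∀ ω, ∏ i ∈ Q.disjSum K, f i ω ^ w i = ENNReal.ofReal (Real.exp
        ((∑ c ∈ Q, Real.log (m fun t => xt S a0 ω (t * c))) / T.card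
      + ∑ h ∈ K, Real.log (r h (xt S a0 ω h)) + (Q.card + K.card) * Real.log k)) := by
      intro ω
      rw [Finset.prod_disjSum]
      have e1 : ∀ c ∈ Q, f (Sum.inl c) ω ^ w (Sum.inl c) = ENNReal.ofReal (Real.exp
          (Real.log (m fun t => xt S a0 ω (t * c)) / T.card + Real.log k)) := by
        intro c _
        simp only [f, w, Sum.elim_inl]
        rw [ofReal_rpow_exp (mul_pos (hm _) (by positivity)),
          Real.log_mul (hm _).ne' (by positivity), Real.log_pow]
        congr 2
        field_simp
      have e2 : ∀ h ∈ K, f (Sum.inr h) ω ^ w (Sum.inr h) = ENNReal.ofReal (Real.exp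
          (Real.log (r h (xt S a0 ω h)) + Real.log k)) := by
        intro h _
        simp only [f, w, Sum.elim_inr]
        rw [ofReal_rpow_exp (mul_pos (hr _ _) (by positivity)),
          Real.log_mul (hr _ _).ne' (by positivity)]
        congr 2
        ring
      rw [Finset.prod_congr rfl e1, Finset.prod_congr rfl e2,
        ← ENNReal.ofReal_prod_of_nonneg fun _ _ => (Real.exp_pos _).le,
        ← ENNReal.ofReal_prod_of_nonneg fun _ _ => (Real.exp_pos _).le,
        ← ENNReal.ofReal_mul (Finset.prod_nonneg fun _ _ => (Real.exp_pos _).le),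
        ← Real.exp_sum, ← Real.exp_sum, ← Real.exp_add]
      congr 2
      rw [Finset.sum_add_distrib, Finset.sum_add_distrib, Finset.sum_const, Finset.sum_const,
        Finset.sum_div]
      simp only [nsmul_eq_mul]
      ring
    simp_rw [e] at key
    rw [Fintype.card_coe, Finset.sum_mul] at key
    have e3 : ((k : ℝ≥0∞)⁻¹) ^ S.card = ENNReal.ofReal (Real.exp (-(S.card * Real.log k))) := by
      rw [Real.exp_neg, mul_comm, Real.exp_mul, Real.exp_log hk0, Real.rpow_natCast,
        ENNReal.ofReal_inv_of_pos (by positivity), ENNReal.ofReal_pow (by positivity),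
        ENNReal.ofReal_natCast, ENNReal.inv_pow]
    rw [e3] at key
    simp_rw [← ENNReal.ofReal_mul (Real.exp_pos _).le, ← Real.exp_add] at key
    rw [← ENNReal.ofReal_sum_of_nonneg fun _ _ => (Real.exp_pos _).le, ENNReal.ofReal_le_one] at key
    refine le_trans (le_of_eq ?_) key
    refine Finset.sum_congr rfl fun ω _ => ?_
    congr 1
    ring
  · rintro (c | h) _
    · simp [w]
    · simp [w]
  · intro v s' hs' hv
    by_cases hvK : (v : G) ∈ K
    · have : s' ⊆ {Sum.inr (v : G)} := by
        rintro (c | h) hi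
        · exfalso
          have h1 := hv _ hi
          have h2 := hs' hi
          simp only [Finset.inl_mem_disjSum] at h2
          simp only [SS, Sum.elim_inl] at h1
          have h1 : (v : G) ∈ tile T c := h1
          rw [mem_tile] at h1
          have := (hQ c h2 _ h1).2
          simp at this
          exact this hvK
        · have h1 : (v : G) = h := hv _ hi
          simp [h1]
      refine (Finset.sum_le_sum_of_subset_of_nonneg this ?_).trans ?_
      · rintro (c | h) _ _ <;> simp [w]
      · simp [w]
    · have hsub : s' ⊆ (Q.filter fun c => (v : G) ∈ tile T c).disjSum ∅ := by
        rintro (c | h) hi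
        · have h1 : (v : G) ∈ tile T c := hv _ hi
          have h2 := hs' hi
          simp only [Finset.inl_mem_disjSum] at h2
          simp [h1, h2]
        · exfalso
          have h1 : (v : G) = h := hv _ hi
          have h2 := hs' hi
          simp only [Finset.inr_mem_disjSum] at h2
          exact hvK (h1 ▸ h2)
      refine (Finset.sum_le_sum_of_subset_of_nonneg hsub ?_).trans ?_
      · rintro (c | h) _ _ <;> simp [w]
      · rw [Finset.sum_disjSum]
        simp only [w, Sum.elim_inl, Finset.sum_const, Finset.sum_empty, add_zero, nsmul_eq_mul]
        rw [mul_one_div, div_le_one hTpos]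
        exact_mod_cast card_tile_mem_le T Q (v : G)
  · rintro (c | h) hi ω ω' hag
    · simp only [f, Sum.elim_inl]
      simp only [Finset.inl_mem_disjSum] at hi
      congr 3
      ext t
      have hmem := (hQ c hi t t.2).1
      have : ω ⟨t * c, hmem⟩ = ω' ⟨t * c, hmem⟩ := hag _ (by
        change (t : G) * c ∈ tile T c
        rw [mem_tile]; simp)
      simp [xt, hmem, this]
    · simp only [f, Sum.elim_inr]
      simp only [Finset.inr_mem_disjSum] at hi
      have : ω ⟨h, hK hi⟩ = ω' ⟨h, hK hi⟩ := hag _ rfl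
      simp [xt, hK hi, this]
  · rintro (c | h) hi
    · simp only [Finset.inl_mem_disjSum] at hi
      have := int_le_one hk m (fun u => (hm u).le) hms
        (fun t : ↥T => (⟨t * c, (hQ c hi t t.2).1⟩ : ↥S))
        (fun a b hab => by
          simp only [Subtype.mk.injEq] at hab
          exact Subtype.ext (mul_right_cancel hab))
      refine le_trans (le_of_eq ?_) this
      refine lintegral_congr fun ω => ?_
      simp only [f, Sum.elim_inl, Fintype.card_coe]
      congr 3
      ext t
      simp [xt, (hQ c hi t t.2).1]
    · simp only [Finset.inr_mem_disjSum] at hi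
      have := int_le_one hk (V := ↥S) (T := Unit) (fun u => r h (u ())) (fun u => (hr h _).le)
        (by
          refine le_trans (le_of_eq ?_) (hrs h)
          exact Fintype.sum_equiv (Equiv.funUnique Unit (Fin k)) _ _ (fun u => rfl))
        (fun _ => (⟨h, hK hi⟩ : ↥S)) (fun a b _ => rfl)
      refine le_trans (le_of_eq ?_) this
      refine lintegral_congr fun ω => ?_
      simp [f, xt, hK hi]

end Coder

section Words
variable {G : Type*} [Group G] [DecidableEq G] {X : Type*} [MeasurableSpace X] [MulAction G X]

/-- the name of `x` along `S` -/
def word {A : Type*} (α : X → A) (S : Finset G) (x : X) : ↥S → A := fun g => α ((g : G) • x)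

/-- mass of a cylinder -/
noncomputable def cyl {A : Type*} (μ : Measure X) (α : X → A) (S : Finset G) (u : ↥S → A) : ℝ :=
  (μ {x | ∀ g : ↥S, α ((g : G) • x) = u g}).toReal

/-- smoothed word measure -/
noncomputable def wm {k : ℕ} (μ : Measure X) (α : X → Fin k) (S : Finset G) (u : ↥S → Fin k) : ℝ :=
  (cyl μ α S u + ((k : ℝ) ^ S.card)⁻¹) / 2

/-- smoothed information function -/
noncomputable def JJ {k : ℕ} (μ : Measure X) (α : X → Fin k) (S : Finset G) (x : X) : ℝ :=
  -Real.log (wm μ α S (word α S x))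

lemma cyl_nonneg {A : Type*} (μ : Measure X) (α : X → A) (S : Finset G) (u : ↥S → A) :
    0 ≤ cyl μ α S u := ENNReal.toReal_nonneg

lemma wm_pos {k : ℕ} (hk : 0 < k) (μ : Measure X) (α : X → Fin k) (S : Finset G)
    (u : ↥S → Fin k) : 0 < wm μ α S u := by
  have : (0 : ℝ) < k := by exact_mod_cast hk
  have h2 := cyl_nonneg μ α S u
  unfold wm; positivity

lemma wm_ge {k : ℕ} (hk : 0 < k) (μ : Measure X) (α : X → Fin k) (S : Finset G)
    (u : ↥S → Fin k) : ((k : ℝ) ^ S.card)⁻¹ / 2 ≤ wm μ α S u := by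
  have h2 := cyl_nonneg μ α S u
  unfold wm; linarith

variable [MeasurableConstSMul G X]

lemma word_measurable {k : ℕ} {α : X → Fin k} (hα : Measurable α) (S : Finset G) :
    Measurable (word α S) :=
  measurable_pi_lambda _ fun g => hα.comp (measurable_const_smul (g : G))

lemma cyl_eq {k : ℕ} (μ : Measure X) {α : X → Fin k} (hα : Measurable α) (S : Finset G)
    (u : ↥S → Fin k) : cyl μ α S u = (μ.map (word α S)).real {u} := by
  rw [measureReal_def, Measure.map_apply (word_measurable hα S) (measurableSet_singleton u), cyl]
  congr 2
  ext x
  simp only [mem_preimage, mem_singleton_iff]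
  exact funext_iff.symm

lemma integral_word {k : ℕ} (μ : Measure X) [IsProbabilityMeasure μ] {α : X → Fin k}
    (hα : Measurable α) (S : Finset G) (φ : (↥S → Fin k) → ℝ) :
    ∫ x, φ (word α S x) ∂μ = ∑ u, cyl μ α S u * φ u := by
  haveI : IsProbabilityMeasure (μ.map (word α S)) :=
    Measure.isProbabilityMeasure_map (word_measurable hα S).aemeasurable
  rw [← integral_map (word_measurable hα S).aemeasurable
    (measurable_of_countable φ).aestronglyMeasurable, integral_fintype (Integrable.of_finite)]
  simp [cyl_eq μ hα]

lemma cyl_sum {k : ℕ} (μ : Measure X) [IsProbabilityMeasure μ] {α : X → Fin k}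
    (hα : Measurable α) (S : Finset G) : ∑ u, cyl μ α S u = 1 := by
  have := integral_word μ hα S (fun _ => 1)
  simpa using this.symm

lemma cyl_le_one {A : Type*} (μ : Measure X) [IsProbabilityMeasure μ] (α : X → A)
    (S : Finset G) (u : ↥S → A) : cyl μ α S u ≤ 1 := by
  unfold cyl
  exact measureReal_le_one

lemma wm_sum {k : ℕ} (hk : 0 < k) (μ : Measure X) [IsProbabilityMeasure μ] {α : X → Fin k}
    (hα : Measurable α) (S : Finset G) : ∑ u, wm μ α S u = 1 := by
  have : (0 : ℝ) < k := by exact_mod_cast hk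
  unfold wm
  rw [← Finset.sum_div, Finset.sum_add_distrib, cyl_sum μ hα, Finset.sum_const, Finset.card_univ]
  simp only [Fintype.card_fun, Fintype.card_coe, Fintype.card_fin, nsmul_eq_mul, Nat.cast_pow]
  rw [mul_inv_cancel₀ (by positivity)]
  norm_num

lemma JJ_nonneg {k : ℕ} (hk : 0 < k) (μ : Measure X) [IsProbabilityMeasure μ] {α : X → Fin k}
    (hα : Measurable α) (S : Finset G) (x : X) : 0 ≤ JJ μ α S x := by
  unfold JJ
  have h := Real.log_nonpos (wm_pos hk μ α S (word α S x)).le (by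
    rw [← wm_sum hk μ hα S]
    exact Finset.single_le_sum (fun u _ => (wm_pos hk μ α S u).le) (Finset.mem_univ _))
  linarith

lemma JJ_le {k : ℕ} (hk : 0 < k) (μ : Measure X) (α : X → Fin k)
    (S : Finset G) (x : X) : JJ μ α S x ≤ S.card * Real.log k + Real.log 2 := by
  have hk0 : (0 : ℝ) < k := by exact_mod_cast hk
  have h := Real.log_le_log (by positivity) (wm_ge hk μ α S (word α S x))
  rw [Real.log_div (by positivity) (by norm_num), Real.log_inv, Real.log_pow] at h
  unfold JJ; linarith

lemma JJ_measurable {k : ℕ} (μ : Measure X) {α : X → Fin k}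
    (hα : Measurable α) (S : Finset G) : Measurable (JJ μ α S) :=
  (measurable_of_countable fun u : ↥S → Fin k => -Real.log (wm μ α S u)).comp (word_measurable hα S)

lemma JJ_le_info {k : ℕ} (μ : Measure X) (α : X → Fin k)
    (S : Finset G) (x : X) (h : 0 < cyl μ α S (word α S x)) :
    JJ μ α S x ≤ -Real.log (cyl μ α S (word α S x)) + Real.log 2 := by
  have h2 : cyl μ α S (word α S x) / 2 ≤ wm μ α S (word α S x) := by
    have : (0 : ℝ) ≤ ((k : ℝ) ^ S.card)⁻¹ := by positivity
    unfold wm; linarith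
  have := Real.log_le_log (by positivity) h2
  rw [Real.log_div h.ne' (by norm_num)] at this
  unfold JJ; linarith

lemma gibbs_fin {ι : Type*} (s : Finset ι) (p q : ι → ℝ) (hp : ∀ i ∈ s, 0 ≤ p i)
    (hq : ∀ i ∈ s, 0 < q i)
    (h : ∑ i ∈ s, q i ≤ ∑ i ∈ s, p i) : ∑ i ∈ s, Real.negMulLog (p i) ≤ ∑ i ∈ s, p i * (-Real.log (q i)) := by
  have : ∀ i ∈ s, Real.negMulLog (p i) - p i * (-Real.log (q i)) ≤ q i - p i := by
    intro i hi
    rcases (hp i hi).eq_or_lt with h0 | h0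
    · rw [← h0]; simp [(hq i hi).le]
    · have := Real.log_le_sub_one_of_pos (div_pos (hq i hi) h0)
      rw [Real.log_div (hq i hi).ne' h0.ne'] at this
      have h3 := mul_le_mul_of_nonneg_left this h0.le
      have h4 : p i * (q i / p i - 1) = q i - p i := by field_simp
      rw [h4] at h3
      unfold Real.negMulLog
      linarith
  have h2 := Finset.sum_le_sum this
  rw [Finset.sum_sub_distrib, Finset.sum_sub_distrib] at h2
  linarith

lemma entropy_le {k : ℕ} (μ : Measure X) [IsProbabilityMeasure μ] {α : X → Fin k}
    (hα : Measurable α) (S : Finset G) (q : (↥S → Fin k) → ℝ) (hq : ∀ u, 0 < q u)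
    (hs : ∑ u, q u ≤ 1) : partitionEntropy μ α S ≤ ∫ x, -Real.log (q (word α S x)) ∂μ := by
  rw [integral_word μ hα S fun u => -Real.log (q u)]
  exact gibbs_fin _ _ _ (fun u _ => cyl_nonneg _ _ _ _) (fun u _ => hq u) (hs.trans (cyl_sum μ hα S).ge)

lemma JJ_integral_le {k : ℕ} (μ : Measure X) [IsProbabilityMeasure μ] {α : X → Fin k}
    (hα : Measurable α) (S : Finset G) :
    ∫ x, JJ μ α S x ∂μ ≤ partitionEntropy μ α S + Real.log 2 := by
  have h1 := integral_word μ hα S fun u => -Real.log (wm μ α S u)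
  have h2 : partitionEntropy μ α S + Real.log 2
      = ∑ u, (Real.negMulLog (cyl μ α S u) + cyl μ α S u * Real.log 2) := by
    rw [Finset.sum_add_distrib, ← Finset.sum_mul, cyl_sum μ hα, one_mul]; rfl
  rw [h2]
  unfold JJ
  rw [h1]
  refine Finset.sum_le_sum fun u _ => ?_
  rcases (cyl_nonneg μ α S u).eq_or_lt with h0 | h0
  · rw [← h0]; simp
  · have h2 : cyl μ α S u / 2 ≤ wm μ α S u := by
      have : (0 : ℝ) ≤ ((k : ℝ) ^ S.card)⁻¹ := by positivity
      unfold wm; linarith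
    have := Real.log_le_log (by positivity) h2
    rw [Real.log_div h0.ne' (by norm_num)] at this
    unfold Real.negMulLog
    nlinarith

lemma markov_code {k : ℕ} (μ : Measure X) [IsProbabilityMeasure μ] {α : X → Fin k}
    (hα : Measurable α) {F : ℕ → Finset G} (hG : GrowthCond F)
    (q : (n : ℕ) → (↥(F n) → Fin k) → ℝ) (hq : ∀ n u, 0 < q n u) (hs : ∀ n, ∑ u, q n u ≤ 1)
    (s : ℝ) (hs0 : 0 < s) :
    ∀ᵐ x ∂μ, ∀ᶠ n in atTop, q n (word α (F n) x) * Real.exp (-s * (F n).card)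
      ≤ cyl μ α (F n) (word α (F n) x) := by
  set B : ℕ → Set X := fun n => word α (F n) ⁻¹' {u | cyl μ α (F n) u <
    q n u * Real.exp (-s * (F n).card)} with hB
  have hle : ∀ n, μ.real (B n) ≤ Real.exp (-s * (F n).card) := by
    intro n
    have h1 : μ.real (B n) = (μ.map (word α (F n))).real {u | cyl μ α (F n) u <
        q n u * Real.exp (-s * (F n).card)} := by
      rw [measureReal_def, measureReal_def, Measure.map_apply (word_measurable hα _)
        (Set.toFinite _).measurableSet]
    classical
    rw [h1, ← Finset.coe_filter_univ, ← sum_measureReal_singleton]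
    calc _ ≤ ∑ u ∈ Finset.univ.filter (fun u => cyl μ α (F n) u <
          q n u * Real.exp (-s * (F n).card)), q n u * Real.exp (-s * (F n).card) := by
          refine Finset.sum_le_sum fun u hu => ?_
          rw [← cyl_eq μ hα]
          exact (Finset.mem_filter.1 hu).2.le
      _ ≤ ∑ u, q n u * Real.exp (-s * (F n).card) :=
          Finset.sum_le_sum_of_subset_of_nonneg (Finset.subset_univ _)
            (fun u _ _ => (mul_pos (hq n u) (Real.exp_pos _)).le)
      _ ≤ _ := by
          rw [← Finset.sum_mul]
          exact mul_le_of_le_one_left (Real.exp_pos _).le (hs n)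
  have hsum : ∑' n, μ (B n) ≠ ⊤ := by
    have h2 : ∀ n, μ (B n) ≤ ENNReal.ofReal (Real.exp (-s * (F n).card)) := fun n => by
      rw [← ofReal_measureReal]
      exact ENNReal.ofReal_le_ofReal (hle n)
    refine ne_top_of_le_ne_top ?_ (ENNReal.tsum_le_tsum h2)
    exact (growth_summable hG s hs0).tsum_ofReal_ne_top
  filter_upwards [ae_eventually_notMem hsum] with x hx
  filter_upwards [hx] with n hn
  exact not_lt.1 hn

end Words

section Upper
variable {G : Type*} [Group G] [DecidableEq G] {X : Type*} [MeasurableSpace X] [MulAction G X]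

lemma xt_word {A : Type*} (α : X → A) (S : Finset G) (a0 : A) (x : X) {g : G} (hg : g ∈ S) :
    xt S a0 (word α S x) g = α (g • x) := by
  simp [xt, hg, word]

lemma word_smul {A : Type*} (α : X → A) (S T : Finset G) (a0 : A) (x : X) {c : G}
    (h : ∀ t ∈ T, t * c ∈ S) :
    (fun t : ↥T => xt S a0 (word α S x) (t * c)) = word α T (c • x) := by
  ext t
  rw [xt_word α S a0 x (h t t.2), mul_smul]; rfl

variable [MeasurableConstSMul G X]

lemma upper1 {k : ℕ} (hk : 0 < k) (μ : Measure X) [IsProbabilityMeasure μ] {α : X → Fin k}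
    (hα : Measurable α) {F : ℕ → Finset G} (hFol : IsFolnerSeq F) (hG : GrowthCond F)
    (T : Finset G) (hT : T.Nonempty) (s : ℝ) (hs0 : 0 < s) :
    ∀ᵐ x ∂μ, ∀ᶠ n in atTop, 0 < cyl μ α (F n) (word α (F n) x) ∧
      -Real.log (cyl μ α (F n) (word α (F n) x)) ≤
        (F n).card * (avg F (JJ μ α T) n x / T.card + s * (Real.log k + 1)) := by
  let a0 : Fin k := ⟨0, hk⟩
  have hTpos : (0 : ℝ) < T.card := by exact_mod_cast hT.card_pos
  let q : (n : ℕ) → (↥(F n) → Fin k) → ℝ := fun n ω =>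
    Real.exp ((∑ c ∈ intr T (F n), Real.log (wm μ α T fun t => xt (F n) a0 ω (t * c))) / T.card
      - (((F n).card : ℝ) - (intr T (F n)).card) * Real.log k)
  have hq1 : ∀ n, ∑ u, q n u ≤ 1 := by
    intro n
    have := coder hk a0 (F n) ∅ (intr T (F n)) T hT (Finset.empty_subset _)
      (fun c hc t ht => ⟨(Finset.mem_filter.1 hc).2 t ht, Finset.notMem_empty _⟩)
      (wm μ α T) (wm_pos hk μ α T) (wm_sum hk μ hα T).le
      (fun _ _ => 1 / k) (fun _ _ => by positivity)
      (fun _ => by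
        have : (k : ℝ) ≠ 0 := by exact_mod_cast hk.ne'
        simp [this])
    refine le_trans (le_of_eq ?_) this
    refine Finset.sum_congr rfl fun u _ => ?_
    simp [q]
  filter_upwards [markov_code μ hα hG q (fun n u => Real.exp_pos _) hq1 s hs0] with x hx
  filter_upwards [hx, folner_intr hFol T s hs0] with n hn hi
  have hpos : (0 : ℝ) < (F n).card := by exact_mod_cast (hFol.1 n).card_pos
  have h0 : 0 < q n (word α (F n) x) * Real.exp (-s * (F n).card) :=
    mul_pos (Real.exp_pos _) (Real.exp_pos _)
  refine ⟨h0.trans_le hn, ?_⟩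
  have h1 := Real.log_le_log h0 hn
  rw [Real.log_mul (Real.exp_pos _).ne' (Real.exp_pos _).ne', Real.log_exp, Real.log_exp] at h1
  have h2 : ∑ c ∈ intr T (F n), Real.log (wm μ α T fun t => xt (F n) a0 (word α (F n) x) (t * c))
      = - ∑ c ∈ intr T (F n), JJ μ α T (c • x) := by
    rw [← Finset.sum_neg_distrib]
    refine Finset.sum_congr rfl fun c hc => ?_
    rw [word_smul α (F n) T a0 x (Finset.mem_filter.1 hc).2]
    simp [JJ]
  rw [h2] at h1
  have h3 : ∑ c ∈ intr T (F n), JJ μ α T (c • x) ≤ ∑ c ∈ F n, JJ μ α T (c • x) :=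
    Finset.sum_le_sum_of_subset_of_nonneg (Finset.filter_subset _ _)
      (fun c _ _ => JJ_nonneg hk μ hα T _)
  have h4 : (F n).card * (avg F (JJ μ α T) n x / T.card) = (∑ c ∈ F n, JJ μ α T (c • x)) / T.card := by
    unfold avg; field_simp
  have h5 : (∑ c ∈ intr T (F n), JJ μ α T (c • x)) / T.card
      ≤ (∑ c ∈ F n, JJ μ α T (c • x)) / T.card := by gcongr
  have hlk : 0 ≤ Real.log k := Real.log_natCast_nonneg k
  have h6 : (((F n).card : ℝ) - (intr T (F n)).card) * Real.log k ≤ s * (F n).card * Real.log k := by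
    gcongr; linarith
  rw [mul_add, h4]
  rw [neg_div] at h1
  nlinarith

theorem local_ent [Countable G] {k : ℕ} (hk : 0 < k) (μ : Measure X) [IsProbabilityMeasure μ]
    (hinv : InvariantMeasure G μ) {α : X → Fin k}
    (hα : Measurable α) {F : ℕ → Finset G} (hFol : IsFolnerSeq F) (hT : IsTemperedSeq F)
    (hG : GrowthCond F) :
    ∃ (h : X → ℝ) (B : ℝ), Measurable h ∧ (∀ (g : G) x, h (g • x) = h x) ∧ (∀ x, 0 ≤ h x) ∧
      (∀ x, h x ≤ B) ∧
      (∀ᵐ x ∂μ, ∀ s > 0, ∀ᶠ n in atTop, 0 < cyl μ α (F n) (word α (F n) x) ∧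
        -Real.log (cyl μ α (F n) (word α (F n) x)) ≤ (F n).card * (h x + s)) ∧
      Tendsto (fun n => partitionEntropy μ α (F n) / (F n).card) atTop (𝓝 (∫ x, h x ∂μ)) ∧
      (∀ n, (F n).card * ∫ x, h x ∂μ ≤ partitionEntropy μ α (F n) + Real.log 2) ∧
      (∀ s > 0, ∃ m, ∫ x, max (JJ μ α (F m) x / (F m).card - h x) 0 ∂μ ≤ s) := by
  have hpos : ∀ n, (0 : ℝ) < (F n).card := fun n => by exact_mod_cast (hFol.1 n).card_pos
  have hone : ∀ n, (1 : ℝ) ≤ (F n).card := fun n => by exact_mod_cast (hFol.1 n).card_pos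
  have hlk : 0 ≤ Real.log k := Real.log_natCast_nonneg k
  have hl2 : 0 < Real.log 2 := Real.log_pos (by norm_num)
  set B : ℝ := Real.log k + Real.log 2 with hBdef
  let f : ℕ → X → ℝ := fun m x => JJ μ α (F m) x / (F m).card
  have hf0 : ∀ m x, 0 ≤ f m x := fun m x => div_nonneg (JJ_nonneg hk μ hα _ x) (hpos m).le
  have hfB : ∀ m x, f m x ≤ B := by
    intro m x
    have := JJ_le hk μ α (F m) x
    rw [div_le_iff₀ (hpos m)]
    nlinarith [hone m]
  have hfm : ∀ m, Measurable (f m) := fun m => (JJ_measurable μ hα _).div_const _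
  have hp : ∀ m, _ := fun m => pet hFol hT hinv (f m) (hfm m) B
    (fun x => by rw [abs_of_nonneg (hf0 m x)]; exact hfB m x)
  choose fb hfbm hfbi hfbc hfbb hfbint using hp
  let e : ℕ → X → ℝ := fun m x => min (max (fb m x) 0) B
  have hem : ∀ m, Measurable (e m) := fun m => ((hfbm m).max measurable_const).min measurable_const
  have he0 : ∀ m x, 0 ≤ e m x := fun m x => le_min (le_max_right _ _) (by positivity)
  have heB : ∀ m x, e m x ≤ B := fun m x => min_le_right _ _
  have hbdd : ∀ x, BddBelow (range fun m => e m x) := fun x => ⟨0, by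
    rintro _ ⟨m, rfl⟩; exact he0 m x⟩
  have hee : ∀ m, e m =ᵐ[μ] fb m := by
    intro m
    filter_upwards [hfbc m, hfbb m] with x hx hb
    have h0 : 0 ≤ fb m x := ge_of_tendsto hx (Eventually.of_forall fun n =>
      div_nonneg (Finset.sum_nonneg fun _ _ => hf0 m _) (Nat.cast_nonneg _))
    simp only [e]
    rw [max_eq_left h0, min_eq_left ((le_abs_self _).trans hb)]
  let h : X → ℝ := fun x => ⨅ m, e m x
  have hhm : Measurable h := by
    refine Measurable.iInf hem
  have hhe : ∀ m x, h x ≤ e m x := fun m x => ciInf_le (hbdd x) m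
  have hh0 : ∀ x, 0 ≤ h x := fun x => le_ciInf fun m => he0 m x
  have hhB : ∀ x, h x ≤ B := fun x => (hhe 0 x).trans (heB 0 x)
  have hhint : Integrable h μ := Integrable.of_bound hhm.aestronglyMeasurable B
    (ae_of_all _ fun x => by rw [Real.norm_eq_abs, abs_of_nonneg (hh0 x)]; exact hhB x)
  have hfint : ∀ m, Integrable (f m) μ := fun m => Integrable.of_bound (hfm m).aestronglyMeasurable B
    (ae_of_all _ fun x => by rw [Real.norm_eq_abs, abs_of_nonneg (hf0 m x)]; exact hfB m x)
  have heint : ∀ m, Integrable (e m) μ := fun m => Integrable.of_bound (hem m).aestronglyMeasurable B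
    (ae_of_all _ fun x => by rw [Real.norm_eq_abs, abs_of_nonneg (he0 m x)]; exact heB m x)
  -- upper bound
  have hup : ∀ᵐ x ∂μ, ∀ s > 0, ∀ᶠ n in atTop, 0 < cyl μ α (F n) (word α (F n) x) ∧
        -Real.log (cyl μ α (F n) (word α (F n) x)) ≤ (F n).card * (h x + s) := by
    have h1 : ∀ᵐ x ∂μ, ∀ m i : ℕ, ∀ᶠ n in atTop, 0 < cyl μ α (F n) (word α (F n) x) ∧
      -Real.log (cyl μ α (F n) (word α (F n) x)) ≤
        (F n).card * (avg F (JJ μ α (F m)) n x / (F m).card + (1 / ((i : ℝ) + 1)) * (Real.log k + 1)) := by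
      rw [ae_all_iff]; intro m
      rw [ae_all_iff]; intro i
      exact upper1 hk μ hα hFol hG (F m) (hFol.1 m) _ (by positivity)
    filter_upwards [h1, ae_all_iff.2 hfbc, ae_all_iff.2 hee] with x hx hc hex s hs
    obtain ⟨m, hm⟩ : ∃ m, e m x < h x + s / 3 := exists_lt_of_ciInf_lt (by
      change h x < h x + s / 3
      linarith)
    obtain ⟨i, hi⟩ := exists_nat_one_div_lt (show 0 < s / 3 / (Real.log k + 1) by positivity)
    rw [hex m] at hm
    have hc' := (hc m).eventually (gt_mem_nhds (show fb m x < fb m x + s / 3 by linarith))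
    filter_upwards [hx m i, hc'] with n hn hn2
    refine ⟨hn.1, hn.2.trans ?_⟩
    apply mul_le_mul_of_nonneg_left _ (hpos n).le
    have e1 : avg F (JJ μ α (F m)) n x / (F m).card = avg F (f m) n x := by
      simp only [avg, f]
      rw [← Finset.sum_div]
      ring
    rw [e1]
    have e2 : (1 / ((i : ℝ) + 1)) * (Real.log k + 1) ≤ s / 3 := by
      rw [lt_div_iff₀ (by positivity)] at hi
      exact hi.le
    linarith
  -- excess tends to zero
  have hex : Tendsto (fun m => ∫ x, max (f m x - h x) 0 ∂μ) atTop (𝓝 0) := by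
    suffices hh : Tendsto (fun m => ∫ x, max (f m x - h x) 0 ∂μ) atTop (𝓝 (∫ _, (0 : ℝ) ∂μ)) by
      simpa using hh
    refine tendsto_integral_of_dominated_convergence (fun _ => B) (fun n => ?_)
      (integrable_const B) (fun n => ae_of_all _ fun x => ?_) ?_
    · exact (((hfm n).sub hhm).max measurable_const).aestronglyMeasurable
    · rw [Real.norm_eq_abs, abs_of_nonneg (le_max_right _ _)]
      exact max_le (by linarith [hfB n x, hh0 x]) (by positivity)
    · filter_upwards [hup] with x hx
      rw [Metric.tendsto_atTop']
      intro s hs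
      have hlarge := (growth_tendsto hG).eventually_ge_atTop (Real.log 2 / (s / 4))
      have := (hx (s / 4) (by positivity)).and hlarge
      obtain ⟨N, hN⟩ := eventually_atTop.1 this
      refine ⟨N, fun n hn => ?_⟩
      obtain ⟨⟨hc, hI⟩, hl⟩ := hN n hn.le
      rw [Real.dist_eq, sub_zero, abs_of_nonneg (le_max_right _ _)]
      refine max_lt ?_ hs
      have hJ := JJ_le_info μ α (F n) x hc
      rw [div_le_iff₀ (by positivity)] at hl
      have : f n x ≤ h x + s / 4 + s / 4 := by
        rw [div_le_iff₀ (hpos n)]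
        nlinarith
      linarith
  have hmaxint : ∀ m, Integrable (fun x => max (f m x - h x) 0) μ := fun m =>
    ((hfint m).sub hhint).pos_part
  have hfI : ∀ m, ∫ x, f m x ∂μ = (∫ x, JJ μ α (F m) x ∂μ) / (F m).card := fun m =>
    integral_div _ _
  have hlow : ∀ n, (F n).card * ∫ x, h x ∂μ ≤ partitionEntropy μ α (F n) + Real.log 2 := by
    intro n
    have h1 : ∫ x, h x ∂μ ≤ ∫ x, e n x ∂μ := integral_mono hhint (heint n) (hhe n)
    rw [integral_congr_ae (hee n), hfbint n, hfI, le_div_iff₀ (hpos n)] at h1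
    have h2 := JJ_integral_le μ hα (F n)
    linarith
  refine ⟨h, B, hhm, ?_, hh0, hhB, hup, ?_, hlow, ?_⟩
  · intro g x
    simp only [h, e, hfbi]
  · have hl : Tendsto (fun n => ∫ x, h x ∂μ - Real.log 2 / (F n).card) atTop (𝓝 (∫ x, h x ∂μ)) := by
      have := ((growth_tendsto hG).const_div_atTop (Real.log 2)).const_sub (∫ x, h x ∂μ)
      simpa using this
    have hu : Tendsto (fun n => ∫ x, h x ∂μ + ∫ x, max (f n x - h x) 0 ∂μ) atTop
        (𝓝 (∫ x, h x ∂μ)) := by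
      simpa using hex.const_add (∫ x, h x ∂μ)
    refine tendsto_of_tendsto_of_tendsto_of_le_of_le hl hu (fun n => ?_) (fun n => ?_)
    · change _ - _ ≤ _
      rw [sub_le_iff_le_add, ← add_div, le_div_iff₀ (hpos n)]
      linarith [hlow n]
    · change _ ≤ ∫ x, h x ∂μ + ∫ x, max (f n x - h x) 0 ∂μ
      have h1 := entropy_le μ hα (F n) (wm μ α (F n)) (wm_pos hk μ α _) (wm_sum hk μ hα _).le
      have h2 : partitionEntropy μ α (F n) / (F n).card ≤ ∫ x, f n x ∂μ := by
        rw [hfI]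
        gcongr
        exact h1
      refine h2.trans ?_
      rw [← integral_add hhint (hmaxint n)]
      refine integral_mono (hfint n) (hhint.add (hmaxint n)) fun x => ?_
      change f n x ≤ h x + max (f n x - h x) 0
      linarith [le_max_left (f n x - h x) 0]
  · intro s hs
    obtain ⟨m, hm⟩ := (hex.eventually (gt_mem_nhds hs)).exists
    exact ⟨m, hm.le⟩

end Upper

section TileCode
variable {G : Type*} [Group G] [DecidableEq G]

lemma mix_code {k : ℕ} {O : Type*} (S : Finset G) (opts : Finset O) (hne : opts.Nonempty)
    (wt : O → ℝ) (hwt : ∀ o ∈ opts, 0 < wt o) (hsum : ∑ o ∈ opts, wt o ≤ 1) (d : O)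
    (L : (G → O) → (↥S → Fin k) → ℝ) (hL : ∀ Ξ, ∑ ω, Real.exp (-L Ξ ω) ≤ 1) :
    ∃ q : (↥S → Fin k) → ℝ, (∀ ω, 0 < q ω) ∧ ∑ ω, q ω ≤ 1 ∧
      ∀ ω (Ξ : G → O), (∀ c ∈ S, Ξ c ∈ opts) → (∀ c ∉ S, Ξ c = d) →
        -Real.log (q ω) ≤ ∑ c ∈ S, -Real.log (wt (Ξ c)) + L Ξ ω := by
  classical
  set Cf : Finset (↥S → O) := Fintype.piFinset (fun _ : ↥S => opts) with hCf
  have hCfne : Cf.Nonempty := Fintype.piFinset_nonempty.2 fun _ => hne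
  have hW : ∀ p ∈ Cf, 0 < ∏ c, wt (p c) := fun p hp =>
    Finset.prod_pos fun c _ => hwt _ (Fintype.mem_piFinset.1 hp c)
  have hterm : ∀ ω, ∀ p ∈ Cf, 0 < (∏ c, wt (p c)) * Real.exp (-L (xt S d p) ω) := fun ω p hp =>
    mul_pos (hW p hp) (Real.exp_pos _)
  refine ⟨fun ω => ∑ p ∈ Cf, (∏ c, wt (p c)) * Real.exp (-L (xt S d p) ω), ?_, ?_, ?_⟩
  · intro ω
    exact Finset.sum_pos (hterm ω) hCfne
  · rw [Finset.sum_comm]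
    simp_rw [← Finset.mul_sum]
    calc _ ≤ ∑ p ∈ Cf, ∏ c, wt (p c) :=
          Finset.sum_le_sum fun p hp => mul_le_of_le_one_right (hW p hp).le (hL _)
      _ = ∏ _c : ↥S, ∑ o ∈ opts, wt o := (Finset.prod_univ_sum (fun _ : ↥S => opts) fun _ => wt).symm
      _ ≤ 1 := Finset.prod_le_one (fun _ _ => Finset.sum_nonneg fun o ho => (hwt o ho).le)
          (fun _ _ => hsum)
  · intro ω Ξ h1 h2
    have hp : (fun c : ↥S => Ξ c) ∈ Cf := Fintype.mem_piFinset.2 fun c => h1 c c.2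
    have hx : xt S d (fun c : ↥S => Ξ c) = Ξ := by
      ext c
      by_cases hc : c ∈ S
      · simp [xt, hc]
      · simp [xt, hc, h2 c hc]
    have h3 := Finset.single_le_sum (fun p hp => (hterm ω p hp).le) hp
    have h4 := Real.log_le_log (hterm ω _ hp) h3
    rw [Real.log_mul (hW _ hp).ne' (Real.exp_pos _).ne', Real.log_exp, hx,
      Real.log_prod fun (c : ↥S) _ => (hwt _ (h1 c c.2)).ne'] at h4
    rw [Finset.sum_coe_sort S (fun c => Real.log (wt (Ξ c)))] at h4
    rw [Finset.sum_neg_distrib]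
    linarith

/-- region covered by the tiles of a configuration -/
noncomputable def KK {k : ℕ} (F : ℕ → Finset G) (S : Finset G) (Ξ : G → Option (ℕ × (G → Fin k))) : Finset G := by
  classical
  exact S.filter fun h => ∃ p : G × (ℕ × (G → Fin k)), p.1 ∈ S ∧ Ξ p.1 = some p.2 ∧ h * p.1⁻¹ ∈ F p.2.1

/-- predicted letter -/
noncomputable def prd {k : ℕ} (F : ℕ → Finset G) (S : Finset G) (a0 : Fin k)
    (Ξ : G → Option (ℕ × (G → Fin k))) (h : G) : Fin k := by
  classical
  exact if H : ∃ p : G × (ℕ × (G → Fin k)), p.1 ∈ S ∧ Ξ p.1 = some p.2 ∧ h * p.1⁻¹ ∈ F p.2.1 then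
    H.choose.2.2 (h * H.choose.1⁻¹) else a0

/-- good sites outside of the tiles -/
def QQ (S K T : Finset G) : Finset G := (S \ K).filter fun c => ∀ t ∈ T, t * c ∈ S ∧ t * c ∉ K

/-- letter weights -/
noncomputable def rr {k : ℕ} (κ : ℝ) (b a : Fin k) : ℝ := if a = b then 1 - κ else κ / k

lemma rr_pos {k : ℕ} (hk : 0 < k) {κ : ℝ} (h0 : 0 < κ) (h1 : κ < 1) (b a : Fin k) :
    0 < rr κ b a := by
  have : (0 : ℝ) < k := by exact_mod_cast hk
  unfold rr; split_ifs
  · linarith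
  · positivity

lemma rr_sum {k : ℕ} (hk : 0 < k) {κ : ℝ} (h0 : 0 < κ) (h1 : κ < 1) (b : Fin k) :
    ∑ a, rr κ b a ≤ 1 := by
  have hk0 : (0 : ℝ) < k := by exact_mod_cast hk
  have : ∀ a ∈ Finset.univ, rr κ b a ≤ (if a = b then 1 - κ else 0) + κ / k := by
    intro a _
    unfold rr; split_ifs
    · have : 0 < κ / k := by positivity
      linarith
    · linarith
  refine (Finset.sum_le_sum this).trans ?_
  rw [Finset.sum_add_distrib]
  simp
  rw [mul_div_cancel₀ _ hk0.ne']
  linarith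

/-- code length -/
noncomputable def LL {k : ℕ} (F : ℕ → Finset G) (S T : Finset G) (a0 : Fin k) (κ : ℝ)
    (m : (↥T → Fin k) → ℝ) (Ξ : G → Option (ℕ × (G → Fin k))) (ω : ↥S → Fin k) : ℝ :=
  -((∑ c ∈ QQ S (KK F S Ξ) T, Real.log (m fun t => xt S a0 ω (t * c))) / T.card
      + ∑ h ∈ KK F S Ξ, Real.log (rr κ (prd F S a0 Ξ h) (xt S a0 ω h))
      - ((S.card : ℝ) - (QQ S (KK F S Ξ) T).card - (KK F S Ξ).card) * Real.log k)

lemma LL_sum {k : ℕ} (hk : 0 < k) (F : ℕ → Finset G) (S T : Finset G) (hT : T.Nonempty)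
    (a0 : Fin k) {κ : ℝ} (h0 : 0 < κ) (h1 : κ < 1)
    (m : (↥T → Fin k) → ℝ) (hm : ∀ u, 0 < m u) (hms : ∑ u, m u ≤ 1)
    (Ξ : G → Option (ℕ × (G → Fin k))) :
    ∑ ω, Real.exp (-LL F S T a0 κ m Ξ ω) ≤ 1 := by
  unfold LL
  simp_rw [neg_neg]
  refine coder hk a0 S (KK F S Ξ) _ T hT (by classical exact Finset.filter_subset _ _) ?_ m hm hms
    (fun h a => rr κ (prd F S a0 Ξ h) a) (fun h a => rr_pos hk h0 h1 _ _)
    (fun h => rr_sum hk h0 h1 _)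
  intro c hc t ht
  exact (Finset.mem_filter.1 hc).2 t ht

/-- configuration attached to a family of tiles -/
noncomputable def cfg {k : ℕ} (D : Finset G) (j : G → ℕ) (wd : G → G → Fin k) :
    G → Option (ℕ × (G → Fin k)) := fun c => if c ∈ D then some (j c, wd c) else none

lemma cfg_some {k : ℕ} {D : Finset G} {j : G → ℕ} {wd : G → G → Fin k} {c : G}
    {o : ℕ × (G → Fin k)} (h : cfg D j wd c = some o) : c ∈ D ∧ o.1 = j c ∧ o.2 = wd c := by
  unfold cfg at h
  split_ifs at h with hc
  simp only [Option.some.injEq] at h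
  rw [← h]
  exact ⟨hc, rfl, rfl⟩

lemma KK_cfg {k : ℕ} (F : ℕ → Finset G) (S : Finset G) (D : Finset G) (j : G → ℕ)
    (wd : G → G → Fin k) (hD : D ⊆ S) (ht : tiles F j D ⊆ S) :
    KK F S (cfg D j wd) = tiles F j D := by
  classical
  ext h
  simp only [KK, Finset.mem_filter, mem_tiles]
  constructor
  · rintro ⟨_, ⟨c, o⟩, _, h2, h3⟩
    obtain ⟨e1, e2, _⟩ := cfg_some h2
    exact ⟨c, e1, e2 ▸ h3⟩
  · rintro ⟨c, hc, hh⟩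
    exact ⟨ht (mem_tiles.2 ⟨c, hc, hh⟩), (c, (j c, wd c)), hD hc, by simp [cfg, hc], hh⟩

lemma prd_cfg {k : ℕ} (F : ℕ → Finset G) (S : Finset G) (D : Finset G) (j : G → ℕ)
    (wd : G → G → Fin k) (hD : D ⊆ S) (a0 : Fin k) {h : G} (hh : h ∈ tiles F j D) :
    ∃ c ∈ D, h * c⁻¹ ∈ F (j c) ∧ prd F S a0 (cfg D j wd) h = wd c (h * c⁻¹) := by
  classical
  obtain ⟨c, hc, hm⟩ := mem_tiles.1 hh
  have H : ∃ p : G × (ℕ × (G → Fin k)), p.1 ∈ S ∧ cfg D j wd p.1 = some p.2 ∧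
      h * p.1⁻¹ ∈ F p.2.1 := ⟨(c, (j c, wd c)), hD hc, by simp [cfg, hc], hm⟩
  obtain ⟨_, h2, h3⟩ := H.choose_spec
  obtain ⟨e1, e2, e3⟩ := cfg_some h2
  refine ⟨H.choose.1, e1, e2 ▸ h3, ?_⟩
  rw [← e3]
  unfold prd
  rw [dif_pos H]

lemma QQ_count (F : ℕ → Finset G) (S T : Finset G) (D : Finset G) (j : G → ℕ)
    (ht : tiles F j D ⊆ S) :
    (S.card : ℝ) - (QQ S (tiles F j D) T).card - (tiles F j D).card ≤
      ∑ t ∈ T, ((S.filter fun c => t * c ∉ S).card : ℝ) +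
      ∑ c ∈ D, ∑ t ∈ T⁻¹, (((F (j c)).filter fun g => t * g ∉ F (j c)).card : ℝ) := by
  classical
  set K := tiles F j D with hK
  have h1 : (S \ K).card + K.card = S.card := Finset.card_sdiff_add_card_eq_card ht
  have h2 : ((S \ K) \ QQ S K T).card + (QQ S K T).card = (S \ K).card :=
    Finset.card_sdiff_add_card_eq_card (Finset.filter_subset _ _)
  have h3 : ((S \ K) \ QQ S K T) ⊆ (T.biUnion fun t => S.filter fun c => t * c ∉ S) ∪
      D.biUnion fun c => T⁻¹.biUnion fun t =>
        ((F (j c)).filter fun g => t * g ∉ F (j c)).image fun g => t * g * c := by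
    intro b hb
    rw [Finset.mem_sdiff] at hb
    have : ∃ t ∈ T, ¬ (t * b ∈ S ∧ t * b ∉ K) := by
      by_contra hcon
      push Not at hcon
      exact hb.2 (Finset.mem_filter.2 ⟨hb.1, hcon⟩)
    obtain ⟨t, htT, hh⟩ := this
    rw [Finset.mem_union]
    by_cases hS : t * b ∈ S
    · right
      have hKm : t * b ∈ K := by tauto
      obtain ⟨c, hc, hm⟩ := mem_tiles.1 hKm
      rw [Finset.mem_biUnion]
      refine ⟨c, hc, Finset.mem_biUnion.2 ⟨t⁻¹, Finset.inv_mem_inv htT, ?_⟩⟩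
      refine Finset.mem_image.2 ⟨t * b * c⁻¹, Finset.mem_filter.2 ⟨hm, ?_⟩, by group⟩
      intro hcon
      apply (Finset.mem_sdiff.1 hb.1).2
      refine mem_tiles.2 ⟨c, hc, ?_⟩
      convert hcon using 1
      group
    · left
      exact Finset.mem_biUnion.2 ⟨t, htT, Finset.mem_filter.2 ⟨(Finset.mem_sdiff.1 hb.1).1, hS⟩⟩
  have h4 : ((S \ K) \ QQ S K T).card ≤ ∑ t ∈ T, (S.filter fun c => t * c ∉ S).card +
      ∑ c ∈ D, ∑ t ∈ T⁻¹, ((F (j c)).filter fun g => t * g ∉ F (j c)).card := by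
    refine (Finset.card_le_card h3).trans ((Finset.card_union_le _ _).trans ?_)
    refine add_le_add Finset.card_biUnion_le (Finset.card_biUnion_le.trans ?_)
    refine Finset.sum_le_sum fun c _ => Finset.card_biUnion_le.trans ?_
    exact Finset.sum_le_sum fun t _ => Finset.card_image_le
  have h5 : (((S \ K) \ QQ S K T).card : ℝ) ≤ ∑ t ∈ T, ((S.filter fun c => t * c ∉ S).card : ℝ) +
      ∑ c ∈ D, ∑ t ∈ T⁻¹, (((F (j c)).filter fun g => t * g ∉ F (j c)).card : ℝ) := by
    exact_mod_cast h4
  have h1' : ((S \ K).card : ℝ) + K.card = S.card := by exact_mod_cast h1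
  have h2' : (((S \ K) \ QQ S K T).card : ℝ) + (QQ S K T).card = (S \ K).card := by exact_mod_cast h2
  linarith

variable {X : Type*} [MeasurableSpace X] [MulAction G X]

lemma LL_le {k : ℕ} (hk : 0 < k) (F : ℕ → Finset G) (S T : Finset G) (hT : T.Nonempty)
    (a0 : Fin k) {κ : ℝ} (h0 : 0 < κ) (h1 : κ < 1) (μ : Measure X) (α : X → Fin k)
    (D : Finset G) (j : G → ℕ) (wd : G → G → Fin k) (hD : D ⊆ S) (ht : tiles F j D ⊆ S)
    (h : X → ℝ) (hinv : ∀ (g : G) x, h (g • x) = h x) (hh0 : ∀ x, 0 ≤ h x) (W : Set X) (x : X)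
    (hwd : ∀ c ∈ D, ∀ g ∈ F (j c), (g * c) • x ∉ W → α ((g * c) • x) = wd c g) :
    LL F S T a0 κ (wm μ α T) (cfg D j wd) (word α S x) ≤
      ((S.card : ℝ) - (tiles F j D).card) * h x + (tiles F j D).card * (-Real.log (1 - κ))
      + ((S.card : ℝ) - (QQ S (tiles F j D) T).card - (tiles F j D).card) * Real.log k
      + ∑ c ∈ S, (max (JJ μ α T (c • x) / T.card - h (c • x)) 0 +
        W.indicator (fun _ => Real.log (k / κ)) (c • x)) := by
  classical
  have hk0 : (1 : ℝ) ≤ k := by exact_mod_cast hk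
  have hTpos : (0 : ℝ) < T.card := by exact_mod_cast hT.card_pos
  unfold LL
  rw [KK_cfg F S D j wd hD ht]
  set K := tiles F j D with hK
  set Q := QQ S K T with hQ
  have hlog : 0 ≤ Real.log (k / κ) := Real.log_nonneg (by
    rw [le_div_iff₀ h0]; linarith)
  have hind0 : ∀ y, 0 ≤ W.indicator (fun _ => Real.log (k / κ)) y := fun y =>
    Set.indicator_nonneg (fun _ _ => hlog) y
  have hQS : Q ⊆ S := (Finset.filter_subset _ _).trans Finset.sdiff_subset
  have hQK : (Q.card : ℝ) ≤ S.card - K.card := by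
    have e1 : Q.card ≤ (S \ K).card := Finset.card_le_card (Finset.filter_subset _ _)
    have e2 : (S \ K).card + K.card = S.card := Finset.card_sdiff_add_card_eq_card ht
    have e3 : (Q.card : ℝ) + K.card ≤ S.card := by exact_mod_cast (by omega : Q.card + K.card ≤ S.card)
    linarith
  have e1 : -(∑ c ∈ Q, Real.log (wm μ α T fun t => xt S a0 (word α S x) (t * c))) / T.card
      ≤ ((S.card : ℝ) - K.card) * h x + ∑ c ∈ S, max (JJ μ α T (c • x) / T.card - h (c • x)) 0 := by
    have e2 : -(∑ c ∈ Q, Real.log (wm μ α T fun t => xt S a0 (word α S x) (t * c))) / T.card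
        = ∑ c ∈ Q, JJ μ α T (c • x) / T.card := by
      rw [← Finset.sum_neg_distrib, Finset.sum_div]
      refine Finset.sum_congr rfl fun c hc => ?_
      rw [word_smul α S T a0 x (fun t htT => ((Finset.mem_filter.1 hc).2 t htT).1)]
      rfl
    rw [e2]
    calc _ ≤ ∑ c ∈ Q, (h x + max (JJ μ α T (c • x) / T.card - h (c • x)) 0) := by
          refine Finset.sum_le_sum fun c _ => ?_
          have := le_max_left (JJ μ α T (c • x) / T.card - h (c • x)) 0
          rw [hinv c x] at this ⊢
          linarith
      _ = Q.card * h x + ∑ c ∈ Q, max (JJ μ α T (c • x) / T.card - h (c • x)) 0 := by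
          rw [Finset.sum_add_distrib, Finset.sum_const, nsmul_eq_mul]
      _ ≤ _ := by
          refine add_le_add (mul_le_mul_of_nonneg_right hQK (hh0 x)) ?_
          exact Finset.sum_le_sum_of_subset_of_nonneg hQS fun c _ _ => le_max_right _ _
  have e3 : -∑ g ∈ K, Real.log (rr κ (prd F S a0 (cfg D j wd) g) (xt S a0 (word α S x) g))
      ≤ K.card * (-Real.log (1 - κ)) + ∑ c ∈ S, W.indicator (fun _ => Real.log (k / κ)) (c • x) := by
    rw [← Finset.sum_neg_distrib]
    calc _ ≤ ∑ g ∈ K, (-Real.log (1 - κ) + W.indicator (fun _ => Real.log (k / κ)) (g • x)) := by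
          refine Finset.sum_le_sum fun g hg => ?_
          have hl1 : Real.log (1 - κ) ≤ 0 := Real.log_nonpos (by linarith) (by linarith)
          obtain ⟨c, hc, hm, hp⟩ := prd_cfg F S D j wd hD a0 hg
          rw [xt_word α S a0 x (ht hg), hp]
          by_cases hW : g • x ∈ W
          · rw [Set.indicator_of_mem hW]
            unfold rr
            split_ifs
            · linarith
            · rw [Real.log_div h0.ne' (by positivity), Real.log_div (by positivity) h0.ne']
              linarith
          · have := hwd c hc _ hm (by simpa using hW)
            rw [inv_mul_cancel_right] at this
            rw [Set.indicator_of_notMem hW, rr, if_pos this]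
            linarith
      _ = K.card * (-Real.log (1 - κ)) + ∑ g ∈ K, W.indicator (fun _ => Real.log (k / κ)) (g • x) := by
          rw [Finset.sum_add_distrib, Finset.sum_const, nsmul_eq_mul]
      _ ≤ _ := by
          refine add_le_add le_rfl ?_
          exact Finset.sum_le_sum_of_subset_of_nonneg ht fun c _ _ => hind0 _
  rw [Finset.sum_add_distrib]
  rw [neg_div] at e1
  linarith

end TileCode

section CorePt
variable {G : Type*} [Group G] [DecidableEq G] {X : Type*} [MeasurableSpace X] [MulAction G X]

lemma tile_code [MeasurableConstSMul G X] {k : ℕ} (hk : 0 < k) (F : ℕ → Finset G) (S T : Finset G) (hT : T.Nonempty)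
    (a0 : Fin k) {κ : ℝ} (h0 : 0 < κ) (h1 : κ < 1) (μ : Measure X) [IsProbabilityMeasure μ]
    {α : X → Fin k} (hα : Measurable α) (lib : ℕ → Finset (G → Fin k)) (a s : ℝ) (hs : 0 < s)
    (hlib : ∀ n, ((lib n).card : ℝ) ≤ Real.exp (a * (F n).card)) (n0 M : ℕ)
    (hn0 : ∑ j ∈ Finset.Ico n0 M, Real.exp (-s * (F j).card) ≤ 1 - Real.exp (-s)) (ha : 0 ≤ a) :
    ∃ q : (↥S → Fin k) → ℝ, (∀ ω, 0 < q ω) ∧ ∑ ω, q ω ≤ 1 ∧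
      ∀ ω (D : Finset G) (j : G → ℕ) (wd : G → G → Fin k), D ⊆ S →
        (∀ c ∈ D, j c ∈ Finset.Ico n0 M ∧ wd c ∈ lib (j c)) →
        -Real.log (q ω) ≤ s * S.card + (a + s) * ∑ c ∈ D, ((F (j c)).card : ℝ) +
          LL F S T a0 κ (wm μ α T) (cfg D j wd) ω := by
  classical
  let wt : Option (ℕ × (G → Fin k)) → ℝ := fun o =>
    Option.elim o (Real.exp (-s)) (fun p => Real.exp (-((a + s) * (F p.1).card)))
  let o1 : Finset (ℕ × (G → Fin k)) :=
    (Finset.Ico n0 M).biUnion fun j => (lib j).image fun w => (j, w)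
  let opts : Finset (Option (ℕ × (G → Fin k))) := Finset.insertNone o1
  have hwt : ∀ o, 0 < wt o := by
    rintro (_ | p) <;> exact Real.exp_pos _
  have hsum : ∑ o ∈ opts, wt o ≤ 1 := by
    have e0 : ∑ o ∈ opts, wt o = Real.exp (-s) + ∑ p ∈ o1, Real.exp (-((a + s) * (F p.1).card)) := by
      simp only [opts, Finset.sum_insertNone]; rfl
    have e1 : ∑ p ∈ o1, Real.exp (-((a + s) * (F p.1).card))
        = ∑ j ∈ Finset.Ico n0 M, ∑ w ∈ lib j, Real.exp (-((a + s) * (F j).card)) := by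
      rw [Finset.sum_biUnion]
      · refine Finset.sum_congr rfl fun j _ => ?_
        rw [Finset.sum_image]
        intro w _ w' _ hw
        simpa using hw
      · intro i _ j _ hij
        rw [Function.onFun, Finset.disjoint_left]
        intro p hp hp'
        obtain ⟨w, _, rfl⟩ := Finset.mem_image.1 hp
        obtain ⟨w', _, hw'⟩ := Finset.mem_image.1 hp'
        simp only [Prod.mk.injEq] at hw'
        exact hij hw'.1.symm
    have e2 : ∑ j ∈ Finset.Ico n0 M, ∑ w ∈ lib j, Real.exp (-((a + s) * (F j).card))
        ≤ ∑ j ∈ Finset.Ico n0 M, Real.exp (-s * (F j).card) := by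
      refine Finset.sum_le_sum fun j _ => ?_
      rw [Finset.sum_const, nsmul_eq_mul]
      calc _ ≤ Real.exp (a * (F j).card) * Real.exp (-((a + s) * (F j).card)) := by
            gcongr; exact hlib j
        _ = _ := by rw [← Real.exp_add]; congr 1; ring
    rw [e0, e1]; linarith
  obtain ⟨q, hq0, hq1, hq2⟩ := mix_code S opts ⟨none, Finset.none_mem_insertNone⟩ wt (fun o _ => hwt o) hsum none
    (LL F S T a0 κ (wm μ α T)) (LL_sum hk F S T hT a0 h0 h1 (wm μ α T) (wm_pos hk μ α T)
      (wm_sum hk μ hα T).le)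
  refine ⟨q, hq0, hq1, fun ω D j wd hD hj => ?_⟩
  refine (hq2 ω (cfg D j wd) ?_ ?_).trans ?_
  · intro c _
    by_cases hc : c ∈ D
    · simp only [cfg, hc, if_true, opts, Finset.some_mem_insertNone, o1, Finset.mem_biUnion]
      exact ⟨j c, (hj c hc).1, Finset.mem_image.2 ⟨wd c, (hj c hc).2, rfl⟩⟩
    · simp only [cfg, hc, if_false, opts]
      exact Finset.none_mem_insertNone
  · intro c hc
    have : c ∉ D := fun h => hc (hD h)
    simp [cfg, this]
  · gcongr
    have e3 : ∀ c ∈ S, -Real.log (wt (cfg D j wd c)) ≤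
        s + if c ∈ D then (a + s) * ((F (j c)).card : ℝ) else 0 := by
      intro c _
      by_cases hc : c ∈ D
      · simp only [cfg, hc, if_true, wt, Option.elim, Real.log_exp]
        linarith
      · simp only [cfg, hc, if_false, wt, Option.elim, Real.log_exp]
        linarith
    refine (Finset.sum_le_sum e3).trans ?_
    rw [Finset.sum_add_distrib, Finset.sum_const, nsmul_eq_mul, ← Finset.sum_filter,
      Finset.mul_sum]
    have : S.filter (· ∈ D) = D := by
      ext c; simp only [Finset.mem_filter]; exact ⟨fun h => h.2, fun h => ⟨hD h, h⟩⟩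
    rw [this]
    linarith

lemma core_pt [MeasurableConstSMul G X] {k : ℕ} (hk : 0 < k) {F : ℕ → Finset G} (hne : ∀ n, (F n).Nonempty)
    (C : ℝ) (hC0 : 0 ≤ C)
    (hC : ∀ n : ℕ, (((Finset.range n).biUnion fun k => (F k)⁻¹ * F n).card : ℝ) ≤ C * (F n).card)
    (S T : Finset G) (hT : T.Nonempty)
    {κ : ℝ} (h0 : 0 < κ) (h1 : κ < 1) (μ : Measure X) [IsProbabilityMeasure μ]
    {α : X → Fin k} (hα : Measurable α)
    (h : X → ℝ) (hinv : ∀ (g : G) x, h (g • x) = h x) (hh0 : ∀ x, 0 ≤ h x) (W : Set X)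
    (lib : ℕ → Finset (G → Fin k)) (a s : ℝ) (hs : 0 < s)
    (hlib : ∀ n, ((lib n).card : ℝ) ≤ Real.exp (a * (F n).card)) (n0 M : ℕ)
    (hn0 : ∑ j ∈ Finset.Ico n0 M, Real.exp (-s * (F j).card) ≤ 1 - Real.exp (-s)) (ha : 0 ≤ a)
    (E : ℕ → Set X)
    (hE : ∀ n, ∀ x ∈ E n, ∃ w ∈ lib n, ∀ g ∈ F n, g • x ∉ W → α (g • x) = w g)
    (hbd : ∀ j ∈ Finset.Ico n0 M, ∑ t ∈ T⁻¹, (((F j).filter fun g => t * g ∉ F j).card : ℝ) ≤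
      s * (F j).card)
    (hbS : ∑ t ∈ T, ((S.filter fun c => t * c ∉ S).card : ℝ) ≤ s * S.card)
    (η : ℝ) (hη0 : 0 < η) (hη1 : η < 1) (a' γ : ℝ) (hγ : 0 ≤ γ)
    (hcond : (a + s) / (1 - η) - Real.log (1 - κ) ≤ a' - γ) :
    ∃ q : (↥S → Fin k) → ℝ, (∀ ω, 0 < q ω) ∧ ∑ ω, q ω ≤ 1 ∧ ∀ x,
      -Real.log (q (word α S x)) ≤ S.card * h x
        - γ / (1 / η + C / (1 - η)) * ∑ c ∈ intr ((Finset.range M).biUnion F) S,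
          ({x | a' ≤ h x} ∩ ⋃ j ∈ Finset.Ico n0 M, E j).indicator (fun _ => (1 : ℝ)) (c • x)
        + s * (1 + (1 + 1 / (1 - η)) * Real.log k) * S.card
        + ∑ c ∈ S, (max (JJ μ α T (c • x) / T.card - h (c • x)) 0 +
        W.indicator (fun _ => Real.log (k / κ)) (c • x)) := by
  classical
  let a0 : Fin k := ⟨0, hk⟩
  obtain ⟨q, hq0, hq1, hq⟩ := tile_code hk F S T hT a0 h0 h1 μ hα lib a s hs hlib n0 M hn0 ha
  refine ⟨q, hq0, hq1, fun x => ?_⟩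
  set G0 : Set X := {x | a' ≤ h x} ∩ ⋃ j ∈ Finset.Ico n0 M, E j with hG0
  set Cη := 1 / η + C / (1 - η) with hCη
  have h1η : 0 < 1 - η := by linarith
  have hCηpos : 0 < Cη := by positivity
  have hlk : 0 ≤ Real.log k := Real.log_natCast_nonneg k
  set I := intr ((Finset.range M).biUnion F) S with hI
  set A := I.filter fun c => c • x ∈ G0 with hA
  have hsumA : ∑ c ∈ I, G0.indicator (fun _ => (1 : ℝ)) (c • x) = A.card := by
    simp only [Set.indicator_apply]
    rw [Finset.sum_boole]
  rw [hsumA]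
  -- choose tiles
  have hch : ∀ c : G, ∃ p : ℕ × (G → Fin k), c ∈ A → p.1 ∈ Finset.Ico n0 M ∧ p.2 ∈ lib p.1 ∧
      ∀ g ∈ F p.1, (g * c) • x ∉ W → α ((g * c) • x) = p.2 g := by
    intro c
    by_cases hc : c ∈ A
    · have hc' := (Finset.mem_filter.1 hc).2.2
      simp only [mem_iUnion] at hc'
      obtain ⟨j, hj, hx⟩ := hc'
      obtain ⟨w, hw, hwE⟩ := hE j _ hx
      refine ⟨(j, w), fun _ => ⟨hj, hw, fun g hg hW => ?_⟩⟩
      rw [mul_smul] at hW ⊢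
      exact hwE g hg hW
    · exact ⟨(0, fun _ => a0), fun h => absurd h hc⟩
  choose p hp using hch
  let j : G → ℕ := fun c => (p c).1
  let wd : G → G → Fin k := fun c => (p c).2
  obtain ⟨D, hDA, hc1, hc2⟩ := cover F hne C hC0 hC η hη0 hη1 (fun _ => 1) (fun _ => zero_le_one) 1
    one_pos j A (fun c _ => by simp [card_tile])
  simp only [Finset.sum_const, nsmul_eq_mul, mul_one, one_mul] at hc1 hc2
  have hAS : A ⊆ S := (Finset.filter_subset _ _).trans (Finset.filter_subset _ _)
  have hDS : D ⊆ S := hDA.trans hAS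
  have htS : tiles F j D ⊆ S := by
    intro g hg
    obtain ⟨c, hc, hm⟩ := mem_tiles.1 hg
    have hcI : c ∈ I := (Finset.mem_filter.1 (hDA hc)).1
    have := (Finset.mem_filter.1 hcI).2 (g * c⁻¹) (Finset.mem_biUnion.2 ⟨j c,
      Finset.mem_range.2 (Finset.mem_Ico.1 (hp c (hDA hc)).1).2, hm⟩)
    simpa using this
  have hmain := hq (word α S x) D j wd hDS (fun c hc => ⟨(hp c (hDA hc)).1, (hp c (hDA hc)).2.1⟩)
  have hLL := LL_le hk F S T hT a0 h0 h1 μ α D j wd hDS htS h hinv hh0 W x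
    (fun c hc => (hp c (hDA hc)).2.2)
  have hQ := QQ_count F S T D j htS
  set K : ℝ := ((tiles F j D).card : ℝ) with hK
  have hK0 : 0 ≤ K := Nat.cast_nonneg _
  have hKS : K ≤ S.card := Nat.cast_le.2 (Finset.card_le_card htS)
  set Sg : ℝ := ∑ c ∈ D, ((F (j c)).card : ℝ) with hSg
  have hSgK : Sg ≤ K / (1 - η) := by rw [le_div_iff₀ h1η]; linarith
  have hQ2 : ∑ c ∈ D, ∑ t ∈ T⁻¹, (((F (j c)).filter fun g => t * g ∉ F (j c)).card : ℝ)
      ≤ s * Sg := by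
    rw [hSg, Finset.mul_sum]
    exact Finset.sum_le_sum fun c hc => hbd _ (hp c (hDA hc)).1
  have hQ3 : ((S.card : ℝ) - (QQ S (tiles F j D) T).card - K) ≤ s * (1 + 1 / (1 - η)) * S.card := by
    have e1 : s * Sg ≤ s * (1 / (1 - η)) * S.card := by
      rw [mul_assoc]
      apply mul_le_mul_of_nonneg_left _ hs.le
      calc Sg ≤ K / (1 - η) := hSgK
        _ ≤ S.card / (1 - η) := by gcongr
        _ = _ := by ring
    linarith
  have hQ4 := mul_le_mul_of_nonneg_right hQ3 hlk
  have hSg2 : (a + s) * Sg ≤ (a + s) / (1 - η) * K := by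
    calc (a + s) * Sg ≤ (a + s) * (K / (1 - η)) := by gcongr
      _ = _ := by ring
  have hgain : K * ((a + s) / (1 - η) - Real.log (1 - κ)) ≤ K * (h x - γ) := by
    rcases D.eq_empty_or_nonempty with hDe | ⟨c, hc⟩
    · have : K = 0 := by rw [hK, hDe]; simp [tiles]
      rw [this]; simp
    · have hx : a' ≤ h (c • x) := (Finset.mem_filter.1 (hDA hc)).2.1
      rw [hinv] at hx
      exact mul_le_mul_of_nonneg_left (by linarith) hK0
  have hAK : γ / Cη * A.card ≤ γ * K := by
    rw [div_mul_eq_mul_div, div_le_iff₀ hCηpos, mul_assoc]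
    apply mul_le_mul_of_nonneg_left _ hγ
    linarith
  refine hmain.trans ?_
  linarith

end CorePt

section CoreInt
variable {G : Type*} [Group G] [DecidableEq G] {X : Type*} [MeasurableSpace X] [MulAction G X]
  [MeasurableConstSMul G X]

lemma int_shift {μ : Measure X} (hinv : InvariantMeasure G μ) (S : Finset G) (φ : X → ℝ)
    (hφ : Integrable φ μ) :
    Integrable (fun x => ∑ c ∈ S, φ (c • x)) μ ∧
      ∫ x, ∑ c ∈ S, φ (c • x) ∂μ = S.card * ∫ x, φ x ∂μ := by
  have m : ∀ c : G, Integrable (fun x => φ (c • x)) μ := fun c =>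
    (inv_mp hinv c).integrable_comp_of_integrable hφ
  refine ⟨integrable_finset_sum _ fun c _ => m c, ?_⟩
  rw [integral_finset_sum _ fun c _ => m c]
  have e : ∀ c ∈ S, ∫ x, φ (c • x) ∂μ = ∫ x, φ x ∂μ := by
    intro c _
    have h2 := (inv_mp hinv c).map_eq
    have h3 : AEStronglyMeasurable φ (Measure.map (fun x => c • x) μ) := by
      rw [h2]; exact hφ.1
    have := integral_map (μ := μ) (measurable_const_smul c).aemeasurable h3
    rw [h2] at this
    exact this.symm
  rw [Finset.sum_congr rfl e]
  simp

lemma core_int {k : ℕ} (μ : Measure X) [IsProbabilityMeasure μ] (hinv : InvariantMeasure G μ)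
    {α : X → Fin k} (hα : Measurable α) (S I : Finset G) (q : (↥S → Fin k) → ℝ)
    (hq : ∀ u, 0 < q u) (hs : ∑ u, q u ≤ 1) (h e : X → ℝ) (hh : Integrable h μ)
    (he : Integrable e μ) (G0 W : Set X) (hG0 : MeasurableSet G0) (hW : MeasurableSet W)
    (n A b L : ℝ)
    (hpt : ∀ x, -Real.log (q (word α S x)) ≤ n * h x
      - A * ∑ c ∈ I, G0.indicator (fun _ => (1 : ℝ)) (c • x) + b
      + ∑ c ∈ S, (e (c • x) + W.indicator (fun _ => L) (c • x))) :
    partitionEntropy μ α S ≤ n * ∫ x, h x ∂μ - A * (I.card * μ.real G0) + b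
      + S.card * (∫ x, e x ∂μ + μ.real W * L) := by
  have i1 : Integrable (G0.indicator (fun _ => (1 : ℝ))) μ :=
    (integrable_const _).indicator hG0
  have i2 : Integrable (W.indicator (fun _ => L)) μ := (integrable_const _).indicator hW
  obtain ⟨j1, k1⟩ := int_shift hinv I _ i1
  obtain ⟨j2, k2⟩ := int_shift hinv S (fun x => e x + W.indicator (fun _ => L) x) (he.add i2)
  have i3 : Integrable (fun x => n * h x) μ := hh.const_mul n
  have i4 : Integrable (fun x => A * ∑ c ∈ I, G0.indicator (fun _ => (1 : ℝ)) (c • x)) μ :=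
    j1.const_mul A
  have i5 : Integrable (fun x => n * h x -
      A * ∑ c ∈ I, G0.indicator (fun _ => (1 : ℝ)) (c • x)) μ := i3.sub i4
  have i6 : Integrable (fun x => n * h x -
      A * ∑ c ∈ I, G0.indicator (fun _ => (1 : ℝ)) (c • x) + b) μ := i5.add (integrable_const b)
  have i7 : Integrable (fun x => -Real.log (q (word α S x))) μ := by
    have hm : Measurable (fun x => -Real.log (q (word α S x))) :=
      (measurable_of_countable fun u : ↥S → Fin k => -Real.log (q u)).comp (word_measurable hα S)
    refine Integrable.of_bound hm.aestronglyMeasurable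
      (∑ u, ‖-Real.log (q u)‖) (Eventually.of_forall fun x => ?_)
    exact Finset.single_le_sum (f := fun u => ‖-Real.log (q u)‖) (fun _ _ => norm_nonneg _)
      (Finset.mem_univ (word α S x))
  refine (entropy_le μ hα S q hq hs).trans ?_
  refine (integral_mono i7 (i6.add j2) hpt).trans (le_of_eq ?_)
  rw [integral_add' i6 j2, integral_add i5 (integrable_const b), integral_sub i3 i4,
    integral_const_mul, integral_const_mul, k1, k2, integral_add he i2,
    integral_indicator_const _ hG0, integral_indicator_const _ hW]
  simp

end CoreInt

section CoreQ
variable {G : Type*} [Group G] [DecidableEq G] {X : Type*} [MeasurableSpace X] [MulAction G X]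
  [MeasurableConstSMul G X]

lemma tail_small {u : ℕ → ℝ} (hu : Summable u) (h0 : ∀ n, 0 ≤ u n) (ε : ℝ) (hε : 0 < ε) :
    ∀ᶠ n0 in atTop, ∀ M, ∑ j ∈ Finset.Ico n0 M, u j ≤ ε := by
  obtain ⟨s, hs⟩ := summable_iff_vanishing_norm.1 hu ε hε
  obtain ⟨N, hN⟩ := s.exists_nat_subset_range
  filter_upwards [eventually_ge_atTop N] with n0 hn0 M
  refine le_trans (le_abs_self _) (hs _ ?_).le
  rw [Finset.disjoint_left]
  intro a ha ha'
  have h1 := Finset.mem_range.1 (hN ha')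
  have h2 := (Finset.mem_Ico.1 ha).1
  omega

set_option maxHeartbeats 1000000 in
theorem core_Q [Countable G] {k : ℕ} (hk : 0 < k) (μ : Measure X) [IsProbabilityMeasure μ]
    (hinv : InvariantMeasure G μ) {α : X → Fin k}
    (hα : Measurable α) {F : ℕ → Finset G} (hFol : IsFolnerSeq F) (hT : IsTemperedSeq F)
    (hG : GrowthCond F) (h : X → ℝ) (B : ℝ) (hm : Measurable h)
    (hhinv : ∀ (g : G) x, h (g • x) = h x) (hh0 : ∀ x, 0 ≤ h x) (hhB : ∀ x, h x ≤ B)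
    (hH : ∀ n, (F n).card * ∫ x, h x ∂μ ≤ partitionEntropy μ α (F n) + Real.log 2)
    (hex : ∀ s > 0, ∃ m, ∫ x, max (JJ μ α (F m) x / (F m).card - h x) 0 ∂μ ≤ s)
    (a a' : ℝ) (ha : 0 ≤ a) (haa : a < a') (Bd : Set X)
    (hlib : ∀ θ > 0, ∃ (W : Set X) (lib : ℕ → Finset (G → Fin k)) (E : ℕ → Set X),
      MeasurableSet W ∧ μ.real W ≤ θ ∧ (∀ n, MeasurableSet (E n)) ∧
      (∀ n, ((lib n).card : ℝ) ≤ Real.exp (a * (F n).card)) ∧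
      (∀ n, ∀ x ∈ E n, ∃ w ∈ lib n, ∀ g ∈ F n, g • x ∉ W → α (g • x) = w g) ∧
      ∀ x ∈ Bd, ∃ᶠ n in atTop, x ∈ E n) :
    μ (Bd ∩ {x | a' ≤ h x}) = 0 := by
  by_contra hb0
  set b : ℝ := μ.real (Bd ∩ {x | a' ≤ h x}) with hb
  have hbpos : 0 < b := by
    rw [hb, measureReal_def]
    exact ENNReal.toReal_pos hb0 (measure_ne_top _ _)
  obtain ⟨C', hC'⟩ := hT
  set C := max C' 0 with hCdef
  have hC0 : 0 ≤ C := le_max_right _ _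
  have hC : ∀ n : ℕ, (((Finset.range n).biUnion fun k => (F k)⁻¹ * F n).card : ℝ)
      ≤ C * (F n).card := fun n => (hC' n).trans (by gcongr; exact le_max_left _ _)
  set β := a' - a with hβ
  have hβ0 : 0 < β := by linarith
  set η := (β / 8) / (a + β / 8 + 1) with hη
  have hη0 : 0 < η := by positivity
  have hη1 : η < 1 := by rw [hη, div_lt_one (by positivity)]; linarith
  have h1η : 0 < 1 - η := by linarith
  set κ := 1 - Real.exp (-(β / 8)) with hκ
  have hκ0 : 0 < κ := by
    have : Real.exp (-(β / 8)) < 1 := Real.exp_zero ▸ Real.exp_lt_exp.2 (by linarith)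
    linarith
  have hκ1 : κ < 1 := by have := Real.exp_pos (-(β / 8)); linarith
  have hlogκ : Real.log (1 - κ) = -(β / 8) := by
    rw [hκ, sub_sub_cancel, Real.log_exp]
  set Cη := 1 / η + C / (1 - η) with hCη
  have hCηpos : 0 < Cη := by positivity
  set c1 := 1 + (1 + 1 / (1 - η)) * Real.log k with hc1
  have hlk : 0 ≤ Real.log k := Real.log_natCast_nonneg k
  have hc1pos : 0 < c1 := by positivity
  set P := β / 2 / Cη * (b / 4) with hP
  have hPpos : 0 < P := by positivity
  set s := min (1 / 2) (min (β / 8 * (1 - η)) (P / (2 * (c1 + 3)))) with hs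
  have hs0 : 0 < s := by positivity
  have hs1 : s ≤ 1 / 2 := min_le_left _ _
  have hs2 : s ≤ β / 8 * (1 - η) := (min_le_right _ _).trans (min_le_left _ _)
  have hs3 : s * (c1 + 3) < P := by
    have : s ≤ P / (2 * (c1 + 3)) := (min_le_right _ _).trans (min_le_right _ _)
    rw [le_div_iff₀ (by positivity)] at this
    linarith
  have hcond : (a + s) / (1 - η) - Real.log (1 - κ) ≤ a' - β / 2 := by
    rw [hlogκ]
    have e1 : a / (1 - η) ≤ a + β / 8 := by
      rw [div_le_iff₀ h1η]
      have : η * (a + β / 8 + 1) = β / 8 := by rw [hη]; field_simp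
      nlinarith
    have e2 : s / (1 - η) ≤ β / 8 := by rw [div_le_iff₀ h1η]; exact hs2
    rw [add_div]; linarith
  set Lg := Real.log (k / κ) with hLg
  have hLg0 : 0 ≤ Lg := by
    apply Real.log_nonneg
    rw [le_div_iff₀ hκ0]
    have : (1 : ℝ) ≤ k := by exact_mod_cast hk
    linarith
  obtain ⟨m, hmm⟩ := hex s hs0
  set T := F m with hTdef
  have hTne : T.Nonempty := hFol.1 m
  obtain ⟨W, lib, E, hW, hWθ, hEm, hcard, hE, hfreq⟩ := hlib (s / (Lg + 1)) (by positivity)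
  have hWs : μ.real W * Lg ≤ s := by
    rw [le_div_iff₀ (by positivity)] at hWθ
    have := measureReal_nonneg (μ := μ) (s := W)
    nlinarith
  have hexp1 : 0 < 1 - Real.exp (-s) := by
    have : Real.exp (-s) < 1 := Real.exp_zero ▸ Real.exp_lt_exp.2 (by linarith)
    linarith
  obtain ⟨n0, hn0, hn0'⟩ := ((tail_small (growth_summable hG s hs0) (fun n => (Real.exp_pos _).le)
    _ hexp1).and (eventually_forall_ge_atTop.2 (folner_bdry hFol T⁻¹ s hs0))).exists
  set Dh : Set X := {x | a' ≤ h x} with hDh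
  have hDm : MeasurableSet Dh := measurableSet_le measurable_const hm
  -- choose M
  obtain ⟨M, hM⟩ : ∃ M, b / 2 ≤ μ.real (Dh ∩ ⋃ j ∈ Finset.Ico n0 M, E j) := by
    have hmono : Monotone fun M => Dh ∩ ⋃ j ∈ Finset.Ico n0 M, E j := by
      intro M M' hMM
      refine inter_subset_inter_right _ (biUnion_subset_biUnion_left ?_)
      intro j hj
      exact Finset.Ico_subset_Ico_right hMM hj
    have ht := tendsto_measure_iUnion_atTop (μ := μ) hmono
    have hsub : Bd ∩ Dh ⊆ ⋃ M, (Dh ∩ ⋃ j ∈ Finset.Ico n0 M, E j) := by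
      rintro x ⟨hx, hx'⟩
      obtain ⟨n, hn, hxn⟩ := (hfreq x hx).forall_exists_of_atTop n0
      exact mem_iUnion.2 ⟨n + 1, hx', mem_biUnion (x := n) (by simp; omega) hxn⟩
    have hge := measure_mono (μ := μ) hsub
    have hlt : ENNReal.ofReal (b / 2) < μ (Bd ∩ Dh) := by
      rw [ENNReal.ofReal_lt_iff_lt_toReal (by positivity) (measure_ne_top _ _)]
      change b / 2 < b
      linarith
    obtain ⟨M, hM⟩ := (ht.eventually (lt_mem_nhds (hlt.trans_le hge))).exists
    refine ⟨M, ?_⟩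
    change ENNReal.ofReal (b / 2) < μ (Dh ∩ ⋃ j ∈ Finset.Ico n0 M, E j) at hM
    rw [ENNReal.ofReal_lt_iff_lt_toReal (by positivity) (measure_ne_top _ _)] at hM
    exact hM.le
  obtain ⟨N, hN1, hN2, hN3⟩ := ((folner_bdry hFol T s hs0).and
    ((folner_intr hFol ((Finset.range M).biUnion F) s hs0).and
    ((growth_tendsto hG).eventually_ge_atTop (Real.log 2 / s)))).exists
  obtain ⟨q, hq0, hq1, hq⟩ := core_pt hk hFol.1 C hC0 hC (F N) T hTne hκ0 hκ1 μ hα h hhinv hh0 W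
    lib a s hs0 hcard n0 M (hn0 M) ha E hE (fun j hj => hn0' j (Finset.mem_Ico.1 hj).1) hN1 η hη0
    hη1 a' (β / 2) (by positivity) hcond
  have ih : Integrable h μ := Integrable.of_bound hm.aestronglyMeasurable B
    (Eventually.of_forall fun x => by rw [Real.norm_of_nonneg (hh0 x)]; exact hhB x)
  have ie : Integrable (fun x => max (JJ μ α T x / T.card - h x) 0) μ := by
    refine Integrable.of_bound ((((JJ_measurable μ hα T).div_const _).sub hm).max
      measurable_const).aestronglyMeasurable ((T.card * Real.log k + Real.log 2) / T.card)
      (Eventually.of_forall fun x => ?_)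
    rw [Real.norm_of_nonneg (le_max_right _ _)]
    have := JJ_le hk μ α T x
    have h2 : 0 ≤ Real.log 2 := Real.log_nonneg (by norm_num)
    refine max_le ?_ (by positivity)
    have h3 := hh0 x
    have : JJ μ α T x / T.card ≤ (T.card * Real.log k + Real.log 2) / T.card := by gcongr
    linarith
  have hfin := core_int μ hinv hα (F N) (intr ((Finset.range M).biUnion F) (F N)) q hq0 hq1 h _ ih
    ie (Dh ∩ ⋃ j ∈ Finset.Ico n0 M, E j) W
    (hDm.inter (Finset.measurableSet_biUnion _ fun j _ => hEm j)) hW _ _ _ _ hq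
  have hHN := hH N
  set V : ℝ := ((F N).card : ℝ) with hV
  have hVpos : 0 < V := by rw [hV]; exact_mod_cast (hFol.1 N).card_pos
  set I : ℝ := ((intr ((Finset.range M).biUnion F) (F N)).card : ℝ) with hI
  set g0 := μ.real (Dh ∩ ⋃ j ∈ Finset.Ico n0 M, E j) with hg0
  have hlog : Real.log 2 ≤ s * V := by
    have := (div_le_iff₀ hs0).1 hN3
    linarith
  have hIg : V * (b / 4) ≤ I * g0 := by
    have e0 : s * V ≤ 1 / 2 * V := mul_le_mul_of_nonneg_right hs1 hVpos.le
    have e1 : V / 2 ≤ I := by linarith only [e0, hN2]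
    calc V * (b / 4) = V / 2 * (b / 2) := by ring
      _ ≤ I * g0 := by gcongr
  have hgain : V * P ≤ β / 2 / Cη * (I * g0) := by
    calc V * P = β / 2 / Cη * (V * (b / 4)) := by rw [hP]; ring
      _ ≤ _ := by gcongr
  have hlast : V * (∫ x, max (JJ μ α T x / T.card - h x) 0 ∂μ + μ.real W * Lg) ≤ V * (s + s) := by
    gcongr
  have : V * (s * (c1 + 3)) < V * P := by gcongr
  linarith

end CoreQ

section LibP
variable {G : Type*} [Group G] [DecidableEq G] {X : Type*} [MetricSpace X] [CompactSpace X]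
  [MulAction G X] [ContinuousConstSMul G X] [MeasurableSpace X] [BorelSpace X]

lemma bowenBall_isOpen (S : Finset G) (x : X) (ε : ℝ) : IsOpen (bowenBall S x ε) := by
  have : bowenBall S x ε = ⋂ g ∈ S, {y | dist (g • x) (g • y) < ε} := by
    ext y; simp [bowenBall]
  rw [this]
  exact isOpen_biInter_finset fun g _ =>
    isOpen_lt (continuous_const.dist (continuous_const_smul g)) continuous_const


lemma max_family (S : Finset G) (μ : Measure X) [IsProbabilityMeasure μ] (r a : ℝ) (hr : 0 < r) :
    ∃ L : Finset X, (L.card : ℝ) ≤ Real.exp (a * S.card) ∧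
      ∀ x, Real.exp (-a * S.card) ≤ μ.real (bowenBall S x r) →
        ∃ y ∈ L, ∀ g ∈ S, dist (g • y) (g • x) < 2 * r := by
  classical
  let V : Finset X → Prop := fun L => (∀ y ∈ L, Real.exp (-a * S.card) ≤ μ.real (bowenBall S y r)) ∧
    (L : Set X).PairwiseDisjoint fun y => bowenBall S y r
  have hV : ∀ L, V L → (L.card : ℝ) ≤ Real.exp (a * S.card) := by
    rintro L ⟨h1, h2⟩
    have e1 : L.card * Real.exp (-a * S.card) ≤ 1 := by
      calc L.card * Real.exp (-a * S.card) = ∑ y ∈ L, Real.exp (-a * S.card) := by simp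
        _ ≤ ∑ y ∈ L, μ.real (bowenBall S y r) := Finset.sum_le_sum h1
        _ = μ.real (⋃ y ∈ L, bowenBall S y r) :=
          (measureReal_biUnion_finset h2 fun y _ => (bowenBall_isOpen S y r).measurableSet).symm
        _ ≤ 1 := measureReal_le_one
    rw [neg_mul, Real.exp_neg, ← div_eq_mul_inv, div_le_iff₀ (Real.exp_pos _)] at e1
    linarith
  let A : Set ℕ := {c | ∃ L, V L ∧ L.card = c}
  have hA1 : A.Nonempty := ⟨0, ∅, ⟨by simp, by simp⟩, rfl⟩
  have hA2 : BddAbove A := by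
    refine ⟨⌈Real.exp (a * S.card)⌉₊, ?_⟩
    rintro c ⟨L, hL, rfl⟩
    exact_mod_cast (hV L hL).trans (Nat.le_ceil _)
  obtain ⟨L, hL, hLc⟩ := Nat.sSup_mem hA1 hA2
  refine ⟨L, hV L hL, fun x hx => ?_⟩
  by_contra hcon
  push Not at hcon
  have hxL : x ∉ L := by
    intro hxL
    obtain ⟨g, hg, h⟩ := hcon x hxL
    rw [dist_self] at h; linarith
  have hVi : V (insert x L) := by
    refine ⟨?_, ?_⟩
    · intro y hy
      rcases Finset.mem_insert.1 hy with rfl | hy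
      · exact hx
      · exact hL.1 y hy
    · rw [Finset.coe_insert]
      refine hL.2.insert fun y hy _ => ?_
      rw [Set.disjoint_left]
      intro z hz hz'
      obtain ⟨g, hg, h⟩ := hcon y hy
      have h1 : dist (g • x) (g • z) < r := hz g hg
      have h2 : dist (g • y) (g • z) < r := hz' g hg
      have := dist_triangle_right (g • y) (g • x) (g • z)
      linarith
  have : (insert x L).card ≤ sSup A := le_csSup hA2 ⟨_, hVi, rfl⟩
  rw [Finset.card_insert_of_notMem hxL, ← hLc] at this
  omega

lemma exists_lib {k : ℕ} (hk : 0 < k) (μ : Measure X) [IsProbabilityMeasure μ] {α : X → Fin k}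
    (hα : Measurable α) (F : ℕ → Finset G) (a : ℝ) (θ : ℝ) (hθ : 0 < θ) :
    ∃ (W : Set X) (lib : ℕ → Finset (G → Fin k)) (E : ℕ → Set X),
      MeasurableSet W ∧ μ.real W ≤ θ ∧ (∀ n, MeasurableSet (E n)) ∧
      (∀ n, ((lib n).card : ℝ) ≤ Real.exp (a * (F n).card)) ∧
      (∀ n, ∀ x ∈ E n, ∃ w ∈ lib n, ∀ g ∈ F n, g • x ∉ W → α (g • x) = w g) ∧
      ∀ x ∈ {x : X | ∀ δ > 0, ∃ᶠ n in atTop,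
        Real.exp (-a * (F n).card) ≤ μ.real (bowenBall (F n) x δ)}, ∃ᶠ n in atTop, x ∈ E n := by
  classical
  have hε : ENNReal.ofReal (θ / k) ≠ 0 := by
    rw [Ne, ENNReal.ofReal_eq_zero, not_le]; positivity
  have hK : ∀ i : Fin k, ∃ K ⊆ α ⁻¹' {i}, IsClosed K ∧ μ (α ⁻¹' {i} \ K) < ENNReal.ofReal (θ / k) :=
    fun i => (hα (measurableSet_singleton i)).exists_isClosed_sdiff_lt (measure_ne_top _ _) hε
  choose K hKs hKc hKm using hK
  have hKd : ∀ i j, i ≠ j → Disjoint (K i) (K j) := by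
    intro i j hij
    rw [Set.disjoint_left]
    intro x hx hx'
    exact hij ((hKs i hx).symm.trans (hKs j hx'))
  obtain ⟨δ, hδ, hδ0⟩ : ∃ δ : ℝ, (∀ i j, i ≠ j →
      Disjoint (Metric.thickening δ (K i)) (Metric.thickening δ (K j))) ∧ 0 < δ := by
    have : ∀ᶠ δ in 𝓝[>] (0 : ℝ), ∀ i j, i ≠ j →
      Disjoint (Metric.thickening δ (K i)) (Metric.thickening δ (K j)) := by
      rw [eventually_all]; intro i; rw [eventually_all]; intro j
      by_cases hij : i = j
      · exact Eventually.of_forall fun _ h => absurd hij h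
      obtain ⟨d, hd, hdd⟩ := (hKd i j hij).exists_thickenings (hKc i).isCompact (hKc j)
      filter_upwards [Ioo_mem_nhdsGT hd] with δ hδ _
      exact hdd.mono (Metric.thickening_mono hδ.2.le _) (Metric.thickening_mono hδ.2.le _)
    exact (this.and self_mem_nhdsWithin).exists
  have hex : ∀ z : X, ∃ i : Fin k, ∀ j, z ∈ Metric.thickening δ (K j) → j = i := by
    intro z
    by_cases h : ∃ i, z ∈ Metric.thickening δ (K i)
    · obtain ⟨i, hi⟩ := h
      refine ⟨i, fun j hj => ?_⟩
      by_contra hne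
      exact Set.disjoint_left.1 (hδ j i hne) hj hi
    · push Not at h
      exact ⟨⟨0, hk⟩, fun j hj => absurd hj (h j)⟩
  choose w hw using hex
  choose L hLc hL using fun n => max_family (F n) μ (δ / 2) a (by positivity)
  refine ⟨(⋃ i, K i)ᶜ, fun n => (L n).image fun y g => w (g • y),
    fun n => ⋃ y ∈ L n, bowenBall (F n) y δ, ?_, ?_, ?_, ?_, ?_, ?_⟩
  · exact (MeasurableSet.iUnion fun i => (hKc i).measurableSet).compl
  · have hsub : (⋃ i, K i)ᶜ ⊆ ⋃ i, (α ⁻¹' {i} \ K i) := by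
      intro x hx
      simp only [mem_compl_iff, mem_iUnion, not_exists] at hx
      exact mem_iUnion.2 ⟨α x, rfl, hx _⟩
    calc μ.real (⋃ i, K i)ᶜ ≤ μ.real (⋃ i, (α ⁻¹' {i} \ K i)) := measureReal_mono hsub
      _ ≤ ∑ i, μ.real (α ⁻¹' {i} \ K i) := measureReal_iUnion_fintype_le _
      _ ≤ ∑ i : Fin k, θ / k := by
        refine Finset.sum_le_sum fun i _ => ?_
        have := ENNReal.toReal_mono ENNReal.ofReal_ne_top (hKm i).le
        rwa [ENNReal.toReal_ofReal (by positivity)] at this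
      _ = θ := by
        have : (k : ℝ) ≠ 0 := by exact_mod_cast hk.ne'
        simp; field_simp
  · exact fun n => Finset.measurableSet_biUnion _ fun y _ => (bowenBall_isOpen _ _ _).measurableSet
  · exact fun n => (Nat.cast_le.2 Finset.card_image_le).trans (hLc n)
  · intro n x hx
    simp only [mem_iUnion] at hx
    obtain ⟨y, hy, hx⟩ := hx
    refine ⟨_, Finset.mem_image_of_mem _ hy, fun g hg hgW => ?_⟩
    rw [Set.notMem_compl_iff, mem_iUnion] at hgW
    obtain ⟨i, hi⟩ := hgW
    have h1 : α (g • x) = i := hKs i hi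
    rw [h1]
    exact hw _ i (Metric.mem_thickening_iff.2 ⟨_, hi, hx g hg⟩)
  · intro x hx
    refine (hx (δ / 2) (by positivity)).mono fun n hn => ?_
    obtain ⟨y, hy, hyx⟩ := hL n x hn
    refine mem_biUnion hy fun g hg => ?_
    have := hyx g hg
    linarith

end LibP

section Assembly
variable {G : Type*} [Group G] [DecidableEq G] {X : Type*} [MetricSpace X] [CompactSpace X]
  [MulAction G X] [ContinuousConstSMul G X] [MeasurableSpace X] [BorelSpace X]

lemma ae_ball_pos (μ : Measure X) [IsProbabilityMeasure μ] :
    ∀ᵐ x ∂μ, ∀ (S : Finset G) (δ : ℝ), 0 < δ → 0 < μ.real (bowenBall S x δ) := by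
  filter_upwards [Measure.support_mem_ae (μ := μ)] with x hx S δ hδ
  have hxB : x ∈ bowenBall S x δ := fun g _ => by rw [dist_self]; exact hδ
  have := (Measure.mem_support_iff_forall x).1 hx _ ((bowenBall_isOpen S x δ).mem_nhds hxB)
  exact ENNReal.toReal_pos this.ne' (measure_ne_top _ _)

lemma lower_ge [Countable G] {k : ℕ} (hk : 0 < k) (μ : Measure X) [IsProbabilityMeasure μ]
    (hinv : InvariantMeasure G μ) {α : X → Fin k}
    (hα : Measurable α) {F : ℕ → Finset G} (hFol : IsFolnerSeq F) (hT : IsTemperedSeq F)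
    (hG : GrowthCond F) (h : X → ℝ) (B : ℝ) (hm : Measurable h)
    (hhinv : ∀ (g : G) x, h (g • x) = h x) (hh0 : ∀ x, 0 ≤ h x) (hhB : ∀ x, h x ≤ B)
    (hH : ∀ n, (F n).card * ∫ x, h x ∂μ ≤ partitionEntropy μ α (F n) + Real.log 2)
    (hex : ∀ s > 0, ∃ m, ∫ x, max (JJ μ α (F m) x / (F m).card - h x) 0 ∂μ ≤ s) :
    ∀ᵐ x ∂μ, ENNReal.ofReal (h x) ≤ ⨆ (δ : ℝ) (_ : 0 < δ), liminf (fun n =>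
      ENNReal.ofReal (-(Real.log ((μ (bowenBall (F n) x δ)).toReal)) / (F n).card)) atTop := by
  have hnull : ∀ p q : ℚ, 0 ≤ p → p < q → ∀ᵐ x ∂μ, x ∉ ({x : X | ∀ δ > 0, ∃ᶠ n in atTop,
        Real.exp (-(p : ℝ) * (F n).card) ≤ μ.real (bowenBall (F n) x δ)} ∩ {x | (q : ℝ) ≤ h x}) := by
    intro p q hp hpq
    rw [← measure_eq_zero_iff_ae_notMem]
    exact core_Q hk μ hinv hα hFol hT hG h B hm hhinv hh0 hhB hH hex p q (by exact_mod_cast hp)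
      (by exact_mod_cast hpq) _ fun θ hθ => exists_lib hk μ hα F p θ hθ
  have hnull' : ∀ᵐ x ∂μ, ∀ p q : ℚ, 0 ≤ p → p < q → x ∉ ({x : X | ∀ δ > 0, ∃ᶠ n in atTop,
        Real.exp (-(p : ℝ) * (F n).card) ≤ μ.real (bowenBall (F n) x δ)} ∩
        {x | (q : ℝ) ≤ h x}) := by
    rw [ae_all_iff]; intro p; rw [ae_all_iff]; intro q
    by_cases hp : 0 ≤ p
    · by_cases hpq : p < q
      · filter_upwards [hnull p q hp hpq] with x hx _ _ using hx
      · exact Eventually.of_forall fun x _ h => absurd h hpq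
    · exact Eventually.of_forall fun x h => absurd h hp
  filter_upwards [hnull', ae_ball_pos (G := G) μ] with x hx hpos
  by_contra hlt
  rw [not_le] at hlt
  obtain ⟨p, hp0, hp1, hp2⟩ := ENNReal.lt_iff_exists_rat_btwn.1 hlt
  obtain ⟨q, hq0, hq1, hq2⟩ := ENNReal.lt_iff_exists_rat_btwn.1 hp2
  have hpq : (p : ℝ) < q := by
    rw [ENNReal.coe_lt_coe] at hq1
    exact (Real.toNNReal_lt_toNNReal_iff_of_nonneg (by exact_mod_cast hp0)).1 hq1
  have hqh : (q : ℝ) ≤ h x := ((ENNReal.ofReal_lt_ofReal_iff_of_nonneg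
    (by exact_mod_cast hq0)).1 hq2).le
  refine hx p q hp0 (by exact_mod_cast hpq) ⟨fun δ hδ => ?_, hqh⟩
  have h1 : liminf (fun n => ENNReal.ofReal (-(Real.log ((μ (bowenBall (F n) x δ)).toReal)) /
      (F n).card)) atTop < ENNReal.ofReal p := by
    refine lt_of_le_of_lt ?_ hp1
    exact le_iSup₂ (f := fun (δ : ℝ) (_ : 0 < δ) => liminf (fun n => ENNReal.ofReal
      (-(Real.log ((μ (bowenBall (F n) x δ)).toReal)) / (F n).card)) atTop) δ hδ
  refine (frequently_lt_of_liminf_lt (by isBoundedDefault) h1).mono fun n hn => ?_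
  have hc : (0 : ℝ) < (F n).card := by exact_mod_cast (hFol.1 n).card_pos
  have h2 := ENNReal.ofReal_lt_ofReal_iff'.1 hn
  have h3 := (div_lt_iff₀ hc).1 h2.1
  have hB := hpos (F n) δ hδ
  rw [← Real.le_log_iff_exp_le hB]
  change _ ≤ Real.log (μ (bowenBall (F n) x δ)).toReal
  linarith

lemma upper_le {k : ℕ} (μ : Measure X) [IsProbabilityMeasure μ] {α : X → Fin k}
    {F : ℕ → Finset G} (hFol : IsFolnerSeq F) (h : X → ℝ) (d : ℝ)
    (hd : ∀ x y, α x = α y → dist x y < d)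
    (hh : ∀ᵐ x ∂μ, ∀ s > 0, ∀ᶠ n in atTop, 0 < cyl μ α (F n) (word α (F n) x) ∧
        -Real.log (cyl μ α (F n) (word α (F n) x)) ≤ (F n).card * (h x + s)) :
    ∀ᵐ x ∂μ, ∀ δ, d ≤ δ → limsup (fun n =>
      ENNReal.ofReal (-(Real.log ((μ (bowenBall (F n) x δ)).toReal)) / (F n).card)) atTop
      ≤ ENNReal.ofReal (h x) := by
  filter_upwards [hh] with x hx δ hδ
  refine ENNReal.le_of_forall_pos_le_add fun s hs _ => ?_
  have : ENNReal.ofReal (h x + s) ≤ ENNReal.ofReal (h x) + s := by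
    refine ENNReal.ofReal_add_le.trans ?_
    simp
  refine le_trans ?_ this
  refine limsup_le_of_le (by isBoundedDefault) ?_
  filter_upwards [hx s (by exact_mod_cast hs)] with n ⟨hn1, hn2⟩
  have hc : (0 : ℝ) < (F n).card := by exact_mod_cast (hFol.1 n).card_pos
  refine ENNReal.ofReal_le_ofReal ?_
  rw [div_le_iff₀ hc]
  have hsub : cyl μ α (F n) (word α (F n) x) ≤ (μ (bowenBall (F n) x δ)).toReal := by
    refine ENNReal.toReal_mono (measure_ne_top _ _) (measure_mono fun y hy g hg => ?_)
    exact (hd _ _ (hy ⟨g, hg⟩).symm).trans_le hδ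
  have := Real.log_le_log hn1 hsub
  linarith

lemma exists_part [Nonempty X] (δ : ℝ) (hδ : 0 < δ) :
    ∃ (k : ℕ) (α : X → Fin k), Measurable α ∧ ∀ x y, α x = α y → dist x y < δ := by
  classical
  obtain ⟨t, -, ht, hcov⟩ := finite_cover_balls_of_compact (isCompact_univ (X := X)) (half_pos hδ)
  have : Fintype t := ht.fintype
  let β : X → t → Bool := fun x c => decide (x ∈ Metric.ball (c : X) (δ / 2))
  have hβ : Measurable β := by
    refine measurable_pi_lambda _ fun c => ?_
    exact measurable_to_bool (by
      have : (fun x => β x c) ⁻¹' {true} = Metric.ball (c : X) (δ / 2) := by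
        ext x; simp [β]
      rw [this]; exact measurableSet_ball)
  refine ⟨_, fun x => Fintype.equivFin (t → Bool) (β x),
    (measurable_of_countable _).comp hβ, fun x y hxy => ?_⟩
  have hxy' : β x = β y := (Fintype.equivFin _).injective hxy
  obtain ⟨c, hc, hxc⟩ := mem_iUnion₂.1 (hcov (mem_univ x))
  have h1 : β x ⟨c, hc⟩ = true := decide_eq_true hxc
  rw [hxy'] at h1
  have hyc : y ∈ Metric.ball c (δ / 2) := of_decide_eq_true h1
  have := dist_triangle_right x y c
  rw [Metric.mem_ball] at hxc hyc
  linarith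

theorem main_result [Countable G]
    (F : ℕ → Finset G) (hFol : IsFolnerSeq F) (hTemp : IsTemperedSeq F) (hGrow : GrowthCond F)
    (μ : Measure X) [IsProbabilityMeasure μ] (hinv : InvariantMeasure G μ) :
    ∃ h : X → ℝ≥0∞, Measurable h ∧ (∀ g : G, ∀ x : X, h (g • x) = h x) ∧
      (∀ᵐ x ∂μ,
        (⨆ (δ : ℝ) (_ : 0 < δ), liminf (fun n =>
          ENNReal.ofReal (-(Real.log ((μ (bowenBall (F n) x δ)).toReal)) / (F n).card)) atTop)
          = h x ∧
        (⨆ (δ : ℝ) (_ : 0 < δ), limsup (fun n =>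
          ENNReal.ofReal (-(Real.log ((μ (bowenBall (F n) x δ)).toReal)) / (F n).card)) atTop)
          = h x) ∧
      ∫⁻ x, h x ∂μ = measEntropy F μ := by
  have hX : Nonempty X := by
    by_contra hne
    rw [not_nonempty_iff] at hne
    have h1 := measure_univ (μ := μ)
    rw [Set.eq_empty_of_isEmpty (univ : Set X), measure_empty] at h1
    exact zero_ne_one h1
  have hfact : ∀ (k : ℕ) (α : X → Fin k), Measurable α → ∃ h : X → ℝ, Measurable h ∧
      (∀ (g : G) x, h (g • x) = h x) ∧
      (∀ᵐ x ∂μ, ∀ s > 0, ∀ᶠ n in atTop, 0 < cyl μ α (F n) (word α (F n) x) ∧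
        -Real.log (cyl μ α (F n) (word α (F n) x)) ≤ (F n).card * (h x + s)) ∧
      (limsup (fun n => ENNReal.ofReal (partitionEntropy μ α (F n) / (F n).card)) atTop
        = ∫⁻ x, ENNReal.ofReal (h x) ∂μ) ∧
      ∀ᵐ x ∂μ, ENNReal.ofReal (h x) ≤ ⨆ (δ : ℝ) (_ : 0 < δ), liminf (fun n =>
      ENNReal.ofReal (-(Real.log ((μ (bowenBall (F n) x δ)).toReal)) / (F n).card)) atTop := by
    intro k α hα
    have hk : 0 < k := Nat.pos_of_ne_zero fun h0 => by
      subst h0; exact (α hX.some).elim0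
    obtain ⟨h, B, hm, hi, h0, hB, hup, ht, hH, hex⟩ := local_ent hk μ hinv hα hFol hTemp hGrow
    refine ⟨h, hm, hi, hup, ?_, lower_ge hk μ hinv hα hFol hTemp hGrow h B hm hi h0 hB hH hex⟩
    have ih : Integrable h μ := Integrable.of_bound hm.aestronglyMeasurable B
      (Eventually.of_forall fun x => by rw [Real.norm_of_nonneg (h0 x)]; exact hB x)
    rw [← ofReal_integral_eq_lintegral_ofReal ih (Eventually.of_forall h0)]
    exact ((ENNReal.continuous_ofReal.tendsto _).comp ht).limsup_eq
  have hle : ∀ (k : ℕ) (α : X → Fin k), Measurable α →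
      limsup (fun n => ENNReal.ofReal (partitionEntropy μ α (F n) / (F n).card)) atTop
      ≤ measEntropy F μ := by
    intro k α hα
    unfold measEntropy
    exact le_iSup_of_le k (le_iSup_of_le α (le_iSup_of_le hα le_rfl))
  choose k α hα hd using fun i : ℕ => exists_part (X := X) (1 / ((i : ℝ) + 1)) (by positivity)
  choose h hm hi hup hE hlow using fun i => hfact (k i) (α i) (hα i)
  have hae : ∀ᵐ x ∂μ,
        (⨆ (δ : ℝ) (_ : 0 < δ), liminf (fun n =>
          ENNReal.ofReal (-(Real.log ((μ (bowenBall (F n) x δ)).toReal)) / (F n).card)) atTop)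
          = liminf (fun i => ENNReal.ofReal (h i x)) atTop ∧
        (⨆ (δ : ℝ) (_ : 0 < δ), limsup (fun n =>
          ENNReal.ofReal (-(Real.log ((μ (bowenBall (F n) x δ)).toReal)) / (F n).card)) atTop)
          = liminf (fun i => ENNReal.ofReal (h i x)) atTop := by
    have hU := ae_all_iff.2 fun i => upper_le μ hFol (h i) _ (hd i) (hup i)
    filter_upwards [hU, ae_all_iff.2 hlow] with x hx1 hx2
    have a1 : (⨆ (δ : ℝ) (_ : 0 < δ), liminf (fun n =>
          ENNReal.ofReal (-(Real.log ((μ (bowenBall (F n) x δ)).toReal)) / (F n).card)) atTop) ≤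
        (⨆ (δ : ℝ) (_ : 0 < δ), limsup (fun n =>
          ENNReal.ofReal (-(Real.log ((μ (bowenBall (F n) x δ)).toReal)) / (F n).card)) atTop) :=
      iSup₂_mono fun δ _ => liminf_le_limsup
    have a2 : (⨆ (δ : ℝ) (_ : 0 < δ), limsup (fun n =>
          ENNReal.ofReal (-(Real.log ((μ (bowenBall (F n) x δ)).toReal)) / (F n).card)) atTop)
          ≤ liminf (fun i => ENNReal.ofReal (h i x)) atTop := by
      refine iSup₂_le fun δ hδ => le_liminf_of_le (by isBoundedDefault) ?_
      filter_upwards [(tendsto_one_div_add_atTop_nhds_zero_nat (𝕜 := ℝ)).eventually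
        (ge_mem_nhds hδ)] with i hi'
      exact hx1 i δ hi'
    have a3 : liminf (fun i => ENNReal.ofReal (h i x)) atTop ≤
        (⨆ (δ : ℝ) (_ : 0 < δ), liminf (fun n =>
          ENNReal.ofReal (-(Real.log ((μ (bowenBall (F n) x δ)).toReal)) / (F n).card)) atTop) :=
      liminf_le_of_frequently_le' (Eventually.of_forall hx2).frequently
    exact ⟨le_antisymm (a1.trans a2) a3, le_antisymm a2 (a3.trans a1)⟩
  refine ⟨fun x => liminf (fun i => ENNReal.ofReal (h i x)) atTop, ?_, ?_, hae, ?_⟩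
  · exact Measurable.liminf fun i => (hm i).ennreal_ofReal
  · intro g x
    simp only [hi]
  · apply le_antisymm
    · refine (lintegral_liminf_le fun i => (hm i).ennreal_ofReal).trans ?_
      refine liminf_le_of_frequently_le' (Eventually.of_forall fun i => ?_).frequently
      rw [← hE i]
      exact hle _ _ (hα i)
    · unfold measEntropy
      refine iSup_le fun k => iSup_le fun α => iSup_le fun hα => ?_
      obtain ⟨h', -, -, -, e, hl⟩ := hfact k α hα
      rw [e]
      refine lintegral_mono_ae ?_
      filter_upwards [hl, hae] with x hx hx'
      rw [← hx'.1]; exact hx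

end Assembly

end Proof

variable {G : Type*} [Group G] [Countable G] [Infinite G] [DecidableEq G]
  {X : Type*} [MetricSpace X] [CompactSpace X] [MulAction G X] [ContinuousConstSMul G X]
  [MeasurableSpace X] [BorelSpace X]

theorem brinKatok_nonergodic
    (F : ℕ → Finset G) (hFol : IsFolnerSeq F) (hTemp : IsTemperedSeq F) (hGrow : GrowthCond F)
    (μ : Measure X) [IsProbabilityMeasure μ] (hinv : InvariantMeasure G μ) :
    ∃ h : X → ℝ≥0∞, Measurable h ∧ (∀ g : G, ∀ x : X, h (g • x) = h x) ∧
      (∀ᵐ x ∂μ,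
        (⨆ (δ : ℝ) (_ : 0 < δ), liminf (fun n =>
          ENNReal.ofReal (-(Real.log ((μ (bowenBall (F n) x δ)).toReal)) / (F n).card)) atTop)
          = h x ∧
        (⨆ (δ : ℝ) (_ : 0 < δ), limsup (fun n =>
          ENNReal.ofReal (-(Real.log ((μ (bowenBall (F n) x δ)).toReal)) / (F n).card)) atTop)
          = h x) ∧
      ∫⁻ x, h x ∂μ = measEntropy F μ := by
  exact main_result F hFol hTemp hGrow μ hinv
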